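/- arXiv:1007.4084 — 4 statements merged into one kernel-verified Lean document; each statement's English description precedes it below -/
import Mathlib

section
/- Let p be a prime and let G be a finite p-group having exactly three characteristic subgroups (namely 1, a unique proper non-trivial characteristic subgroup, and G). Then the lower p-central series of G terminates in exactly two steps; concretely, the Frattini subgroup Φ(G) is non-trivial, is contained in the center of G, and satisfies Φ(G)^p = 1 (every element of Φ(G) has order dividing p). -/
/-- A finite `p`-group is a UCS group if it has exactly three characteristic
subgroups. -/
def IsUCS (p : ℕ) (G : Type*) [Group G] : Prop :=
  IsPGroup p G ∧ Nat.card {H : Subgroup G // H.Characteristic} = 3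

theorem IsPGroup.exists_orderOf_eq {p : ℕ} [Fact p.Prime] {G : Type*} [Group G] [Finite G]
    [Nontrivial G] (hG : IsPGroup p G) : ∃ g : G, orderOf g = p := by
  obtain ⟨n, hn, hcard⟩ := hG.nontrivial_iff_card.mp ‹_›
  exact exists_prime_orderOf_dvd_card' p (hcard ▸ dvd_pow_self p hn.ne')

theorem IsPGroup.normal_of_isCoatom {p : ℕ} [Fact p.Prime] {G : Type*} [Group G] [Finite G]
    (hG : IsPGroup p G) {M : Subgroup G} (hM : IsCoatom M) : M.Normal :=
  have := hG.isNilpotent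
  Subgroup.NormalizerCondition.normal_of_coatom M Group.normalizerCondition_of_isNilpotent hM

/-- Modulo a maximal subgroup, a finite `p`-group is generated by one element of order `p`. -/
theorem IsPGroup.exists_zpowers_quotient_eq_top {p : ℕ} [Fact p.Prime] {G : Type*} [Group G]
    [Finite G] (hG : IsPGroup p G) {M : Subgroup G} [M.Normal] (hM : IsCoatom M) :
    ∃ g : G ⧸ M, orderOf g = p ∧ Subgroup.zpowers g = ⊤ := by
  have : Nontrivial (G ⧸ M) := by
    rw [QuotientGroup.nontrivial_iff]
    exact hM.1
  obtain ⟨g, hg⟩ := (hG.to_quotient M).exists_orderOf_eq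
  refine ⟨g, hg, ?_⟩
  have hle : M ≤ (Subgroup.zpowers g).comap (QuotientGroup.mk' M) := by
    simpa using (QuotientGroup.mk' M).ker_le_comap (Subgroup.zpowers g)
  have hsurj := QuotientGroup.mk'_surjective M
  rcases hM.le_iff.mp hle with h | h
  · rw [← Subgroup.map_comap_eq_self_of_surjective hsurj (Subgroup.zpowers g), h,
      Subgroup.map_top_of_surjective _ hsurj]
  · have hbot : Subgroup.zpowers g = ⊥ := by
      rw [← Subgroup.map_comap_eq_self_of_surjective hsurj (Subgroup.zpowers g), h,
        QuotientGroup.map_mk'_self]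
    rw [Subgroup.zpowers_eq_bot] at hbot
    exact absurd (hg.symm.trans (orderOf_eq_one_iff.mpr hbot)) (Fact.out : p.Prime).ne_one

theorem IsPGroup.pow_mem_frattini {p : ℕ} [Fact p.Prime] {G : Type*} [Group G] [Finite G]
    (hG : IsPGroup p G) (x : G) : x ^ p ∈ frattini G := by
  simp only [frattini, Order.radical, Subgroup.mem_iInf]
  intro M hM
  have := hG.normal_of_isCoatom hM
  obtain ⟨g, hg, htop⟩ := hG.exists_zpowers_quotient_eq_top hM
  obtain ⟨k, hk⟩ := Subgroup.mem_zpowers_iff.mp (htop ▸ Subgroup.mem_top (x : G ⧸ M))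
  rw [← QuotientGroup.eq_one_iff, QuotientGroup.mk_pow, ← hk, ← zpow_natCast, zpow_comm,
    zpow_natCast, ← hg, pow_orderOf_eq_one, one_zpow]

theorem IsPGroup.inv_mul_mul_mem_frattini {p : ℕ} [Fact p.Prime] {G : Type*} [Group G]
    [Finite G] (hG : IsPGroup p G) (x y : G) : (x * y)⁻¹ * (y * x) ∈ frattini G := by
  simp only [frattini, Order.radical, Subgroup.mem_iInf]
  intro M hM
  have := hG.normal_of_isCoatom hM
  obtain ⟨g, -, htop⟩ := hG.exists_zpowers_quotient_eq_top hM
  obtain ⟨k, hk⟩ := Subgroup.mem_zpowers_iff.mp (htop ▸ Subgroup.mem_top (x : G ⧸ M))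
  obtain ⟨l, hl⟩ := Subgroup.mem_zpowers_iff.mp (htop ▸ Subgroup.mem_top (y : G ⧸ M))
  rw [← QuotientGroup.eq, QuotientGroup.mk_mul, QuotientGroup.mk_mul, ← hk, ← hl, zpow_mul_comm]

theorem exists_linearEquiv_apply_eq {K V : Type*} [DivisionRing K] [AddCommGroup V] [Module K V]
    [FiniteDimensional K V] {a b : V} (ha : a ≠ 0) (hb : b ≠ 0) : ∃ e : V ≃ₗ[K] V, e a = b := by
  obtain ⟨e, he⟩ := Submodule.exists_linearEquiv_restrict_eq
    ((LinearEquiv.coord K V a ha).trans (LinearEquiv.toSpanNonzeroSingleton K V b hb))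
  refine ⟨e, ?_⟩
  rw [← he ⟨a, Submodule.mem_span_singleton_self a⟩, LinearEquiv.trans_apply,
    LinearEquiv.coord_self, LinearEquiv.toSpanNonzeroSingleton_one]

theorem exists_addEquiv_apply_eq {p : ℕ} [Fact p.Prime] {V : Type*} [AddCommGroup V] [Finite V]
    (hV : ∀ x : V, p • x = 0) {a b : V} (ha : a ≠ 0) (hb : b ≠ 0) : ∃ e : V ≃+ V, e a = b := by
  have := AddCommGroup.zmodModule hV
  obtain ⟨e, he⟩ := exists_linearEquiv_apply_eq (K := ZMod p) ha hb
  exact ⟨e.toAddEquiv, he⟩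

theorem exists_mulEquiv_apply_eq {p : ℕ} [Fact p.Prime] {G : Type*} [CommGroup G] [Finite G]
    (hG : ∀ x : G, x ^ p = 1) {a b : G} (ha : a ≠ 1) (hb : b ≠ 1) : ∃ e : G ≃* G, e a = b := by
  obtain ⟨e, he⟩ := exists_addEquiv_apply_eq (p := p) (V := Additive G) (fun x => hG x.toMul)
    (a := .ofMul a) (b := .ofMul b) ha hb
  exact ⟨AddEquiv.toMultiplicative e, he⟩

/-- An elementary abelian `p`-group is characteristically simple. -/
theorem Subgroup.Characteristic.eq_bot_or_eq_top_of_forall_pow_eq_one {p : ℕ} [Fact p.Prime]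
    {G : Type*} [CommGroup G] [Finite G] (hG : ∀ x : G, x ^ p = 1) {H : Subgroup G}
    (hH : H.Characteristic) : H = ⊥ ∨ H = ⊤ := by
  refine H.bot_or_exists_ne_one.imp_right fun ⟨a, haH, ha⟩ => ?_
  refine (Subgroup.eq_top_iff' H).mpr fun b => ?_
  by_cases hb : b = 1
  · exact hb ▸ H.one_mem
  obtain ⟨e, rfl⟩ := exists_mulEquiv_apply_eq hG ha hb
  exact Subgroup.characteristic_iff_le_comap.mp hH e haH

theorem IsPGroup.eq_bot_or_eq_top_of_frattini_eq_bot {p : ℕ} [Fact p.Prime] {G : Type*} [Group G]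
    [Finite G] (hG : IsPGroup p G) (h : frattini G = ⊥) {H : Subgroup G}
    (hH : H.Characteristic) : H = ⊥ ∨ H = ⊤ := by
  let : CommGroup G :=
    { ‹Group G› with
      mul_comm := fun x y => inv_mul_eq_one.mp
        (Subgroup.mem_bot.mp (h ▸ hG.inv_mul_mul_mem_frattini x y)) }
  exact hH.eq_bot_or_eq_top_of_forall_pow_eq_one
    fun x => Subgroup.mem_bot.mp (h ▸ hG.pow_mem_frattini x)

theorem frattini_ne_top {G : Type*} [Group G] [Finite G] [Nontrivial G] : frattini G ≠ ⊤ := by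
  intro h
  exact bot_ne_top (frattini_nongenerating (K := (⊥ : Subgroup G)) (by rw [h, sup_top_eq]))

/-- In a set of three elements, any three distinct ones exhaust it. -/
theorem eq_or_eq_or_eq_of_card_eq_three {α : Type*} (h : Nat.card α = 3) {a b c : α}
    (hab : a ≠ b) (hac : a ≠ c) (hbc : b ≠ c) (x : α) : x = a ∨ x = b ∨ x = c := by
  classical
  have : Finite α := Nat.finite_of_card_ne_zero (by omega)
  have := Fintype.ofFinite α
  have huniv : ({a, b, c} : Finset α) = Finset.univ := by
    rw [← Finset.card_eq_iff_eq_univ, ← Nat.card_eq_fintype_card, h]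
    exact Finset.card_eq_three.mpr ⟨a, b, c, hab, hac, hbc, rfl⟩
  have hx := Finset.mem_univ x
  simpa [← huniv] using hx

/-- The elements of order dividing `n` in a central subgroup. -/
def Subgroup.centralTorsion {G : Type*} [Group G] (H : Subgroup G) (hH : H ≤ Subgroup.center G)
    (n : ℕ) : Subgroup G where
  carrier := {x | x ∈ H ∧ x ^ n = 1}
  one_mem' := ⟨H.one_mem, one_pow n⟩
  mul_mem' := fun {a b} ha hb => ⟨H.mul_mem ha.1 hb.1, by
    rw [Commute.mul_pow ((Subgroup.mem_center_iff.mp (hH ha.1) b).symm), ha.2, hb.2, one_mul]⟩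
  inv_mem' := fun {a} ha => ⟨H.inv_mem ha.1, by rw [inv_pow, ha.2, inv_one]⟩

theorem Subgroup.mem_centralTorsion {G : Type*} [Group G] {H : Subgroup G}
    {hH : H ≤ Subgroup.center G} {n : ℕ} {x : G} :
    x ∈ H.centralTorsion hH n ↔ x ∈ H ∧ x ^ n = 1 := Iff.rfl

theorem Subgroup.centralTorsion_characteristic {G : Type*} [Group G] {H : Subgroup G}
    [hc : H.Characteristic] (hH : H ≤ Subgroup.center G) (n : ℕ) :
    (H.centralTorsion hH n).Characteristic := by
  refine Subgroup.characteristic_iff_le_comap.mpr fun e x hx => ?_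
  refine ⟨Subgroup.characteristic_iff_le_comap.mp hc e hx.1, ?_⟩
  rw [← map_pow, hx.2, map_one]

theorem stmt0 (p : ℕ) (hp : p.Prime) (G : Type*) [Group G] [Finite G]
    (hG : IsUCS p G) :
    frattini G ≠ ⊥ ∧ frattini G ≤ Subgroup.center G ∧
      ∀ x ∈ frattini G, x ^ p = 1 := by
  obtain ⟨hG, hcard⟩ := hG
  have : Fact p.Prime := ⟨hp⟩
  have : Nontrivial G := by
    by_contra hn
    rw [not_nontrivial_iff_subsingleton] at hn
    have : Nat.card {H : Subgroup G // H.Characteristic} ≤ 1 :=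
      Finite.card_le_one_iff_subsingleton.mpr inferInstance
    omega
  let bot' : {H : Subgroup G // H.Characteristic} := ⟨⊥, inferInstance⟩
  let top' : {H : Subgroup G // H.Characteristic} := ⟨⊤, inferInstance⟩
  have hne : frattini G ≠ ⊥ := by
    intro h
    have : Nat.card {H : Subgroup G // H.Characteristic} ≤ Nat.card Bool :=
      Nat.card_le_card_of_surjective (fun b : Bool => cond b bot' top') (fun H =>
        (hG.eq_bot_or_eq_top_of_frattini_eq_bot h H.2).elim
          (fun hH => ⟨true, Subtype.ext hH.symm⟩) (fun hH => ⟨false, Subtype.ext hH.symm⟩))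
    simp [hcard] at this
  have key (H : Subgroup G) (hH : H.Characteristic) (hHbot : H ≠ ⊥) : frattini G ≤ H := by
    rcases eq_or_eq_or_eq_of_card_eq_three hcard (a := bot') (b := top')
      (c := ⟨frattini G, inferInstance⟩) (fun h => bot_ne_top (congrArg Subtype.val h))
      (fun h => hne (congrArg Subtype.val h).symm)
      (fun h => frattini_ne_top (congrArg Subtype.val h).symm) ⟨H, hH⟩ with h | h | h
    · exact absurd (congrArg Subtype.val h) hHbot
    · exact le_top.trans (congrArg Subtype.val h : H = ⊤).ge
    · exact (congrArg Subtype.val h : H = frattini G).ge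
  have hcenter : frattini G ≤ Subgroup.center G :=
    key _ inferInstance hG.bot_lt_center.ne'
  refine ⟨hne, hcenter, fun x hx => ?_⟩
  have : Nontrivial (frattini G) := (Subgroup.nontrivial_iff_ne_bot _).mpr hne
  obtain ⟨g, hg⟩ := (hG.to_subgroup (frattini G)).exists_orderOf_eq
  rw [← Subgroup.orderOf_coe] at hg
  refine (key _ (Subgroup.centralTorsion_characteristic hcenter p) (fun h => ?_) hx).2
  have hmem : (g : G) ∈ (frattini G).centralTorsion hcenter p :=
    ⟨g.2, hg ▸ pow_orderOf_eq_one _⟩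
  rw [h, Subgroup.mem_bot] at hmem
  exact hp.ne_one (hg.symm.trans (orderOf_eq_one_iff.mpr hmem))
end

section
/- Let G be a non-abelian UCS 2-group that is minimally generated by 2 elements (equivalently |G/Φ(G)| = 4). Then G is isomorphic to the quaternion group Q₈ of order 8. Conversely, Q₈ is a UCS 2-group, and moreover the action of Aut(Q₈) on Q₈/Φ(Q₈) induces the full group GL₂(F₂). -/
open Subgroup

namespace QuaternionGroup

/-- The homomorphism out of a generalized quaternion group determined by a pair of elements
satisfying the defining relations. -/
def lift {n : ℕ} [NeZero n] {G : Type*} [Group G] (x y : G) (hx : x ^ (2 * n) = 1)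
    (hy : y * y = x ^ n) (hxy : y * x = x⁻¹ * y) : QuaternionGroup n →* G :=
  have add (i j : ZMod (2 * n)) : x ^ (i + j).val = x ^ i.val * x ^ j.val := by
    rw [ZMod.val_add, ← pow_add, ← pow_mod_orderOf x ((i.val + j.val) % (2 * n)),
      Nat.mod_mod_of_dvd _ (orderOf_dvd_of_pow_eq_one hx), pow_mod_orderOf]
  have neg (i : ZMod (2 * n)) : x ^ (-i).val = (x ^ i.val)⁻¹ := by
    rw [eq_inv_iff_mul_eq_one, ← add, neg_add_cancel, ZMod.val_zero, pow_zero]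
  have conj (k : ℕ) : x ^ k * y = y * (x ^ k)⁻¹ := by
    have h : SemiconjBy y x x⁻¹ := hxy
    have := (h.pow_right k).eq
    rw [inv_pow] at this
    rw [mul_eq_of_eq_inv_mul]
    rw [← mul_assoc, ← this, mul_inv_cancel_right]
  have val_n : x ^ (n : ZMod (2 * n)).val = x ^ n := by
    rw [ZMod.val_natCast, ← pow_mod_orderOf, Nat.mod_mod_of_dvd _ (orderOf_dvd_of_pow_eq_one hx),
      pow_mod_orderOf]
  { toFun
      | a i => x ^ i.val
      | xa i => y * x ^ i.val
    map_one' := by simp only [one_def, ZMod.val_zero, pow_zero]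
    map_mul' := by
      rintro (i | i) (j | j)
      · exact add i j
      · simp only [a_mul_xa, sub_eq_add_neg]
        rw [add_comm, add, neg, ← mul_assoc, ← mul_assoc, conj]
      · simp only [xa_mul_a, add, mul_assoc]
      · simp only [xa_mul_xa, sub_eq_add_neg]
        rw [add_assoc, add_comm j, add, add, neg, val_n, ← hy]
        simp only [mul_assoc]
        rw [← mul_assoc (x ^ i.val) y, conj]
        simp only [mul_assoc] }

section Lift

variable {n : ℕ} [NeZero n] {G : Type*} [Group G] {x y : G} (hx : x ^ (2 * n) = 1)
    (hy : y * y = x ^ n) (hxy : y * x = x⁻¹ * y)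

theorem lift_a (i : ZMod (2 * n)) : lift x y hx hy hxy (a i) = x ^ i.val := rfl

theorem lift_xa (i : ZMod (2 * n)) : lift x y hx hy hxy (xa i) = y * x ^ i.val := rfl

theorem lift_a_one : lift x y hx hy hxy (a 1) = x := by
  have : Fact (1 < 2 * n) := ⟨by have := NeZero.pos n; lia⟩
  rw [lift_a, ZMod.val_one, pow_one]

theorem lift_xa_zero : lift x y hx hy hxy (xa 0) = y := by
  rw [lift_xa, ZMod.val_zero, pow_zero, mul_one]

theorem lift_injective (hord : orderOf x = 2 * n) (hcomm : x * y ≠ y * x) :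
    Function.Injective (lift x y hx hy hxy) := by
  rw [injective_iff_map_eq_one]
  rintro (i | i) h
  · rw [lift_a] at h
    have hlt : i.val < orderOf x := by
      rw [hord]
      exact ZMod.val_lt i
    have := Nat.eq_zero_of_dvd_of_lt (orderOf_dvd_of_pow_eq_one h) hlt
    rw [(ZMod.val_eq_zero i).1 this, a_zero]
  · rw [lift_xa, mul_eq_one_iff_eq_inv] at h
    refine absurd ?_ hcomm
    rw [h]
    exact ((Commute.refl x).pow_right _).inv_right.eq

end Lift

theorem closure_generators (n : ℕ) : closure {(a 1 : QuaternionGroup n), xa 0} = ⊤ := by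
  rw [eq_top_iff]
  have ha (i : ZMod (2 * n)) : a i ∈ closure {(a 1 : QuaternionGroup n), xa 0} := by
    obtain ⟨k, rfl⟩ := ZMod.intCast_surjective i
    have h : a (k : ZMod (2 * n)) = (a 1 : QuaternionGroup n) ^ k := by
      induction k with
      | zero => simp
      | succ k ih => rw [zpow_add_one, ← ih]; simp
      | pred k ih =>
        rw [zpow_sub_one, ← ih, eq_mul_inv_iff_mul_eq]; simp
    rw [h]
    exact zpow_mem (subset_closure (by simp)) k
  rintro (i | i) -
  · exact ha i
  · have := mul_mem (subset_closure (by simp) : xa 0 ∈ closure {(a 1 : QuaternionGroup n), xa 0})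
      (ha i)
    rwa [xa_mul_a, zero_add] at this

theorem exists_mulAut_of_not_commute {x y : QuaternionGroup 2} (h : x * y ≠ y * x) :
    ∃ φ : MulAut (QuaternionGroup 2), φ (a 1) = x ∧ φ (xa 0) = y := by
  have relations : ∀ x y : QuaternionGroup 2, x * y ≠ y * x →
      x ^ (2 * 2) = 1 ∧ y * y = x ^ 2 ∧ y * x = x⁻¹ * y ∧ x ^ 2 ≠ 1 := by decide
  obtain ⟨hx, hy, hxy, hx2⟩ := relations x y h
  have hord : orderOf x = 2 * 2 := orderOf_eq_prime_pow (p := 2) (n := 1) (by simpa using hx2) hx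
  refine ⟨MulEquiv.ofBijective (lift x y hx hy hxy)
    (Finite.injective_iff_bijective.1 (lift_injective hx hy hxy hord h)), ?_, ?_⟩
  · exact lift_a_one hx hy hxy
  · exact lift_xa_zero hx hy hxy

theorem eq_of_characteristic (H : Subgroup (QuaternionGroup 2)) [H.Characteristic] :
    H = ⊥ ∨ H = center (QuaternionGroup 2) ∨ H = ⊤ := by
  by_cases hH : H ≤ center (QuaternionGroup 2)
  · have hcenter : ∀ g : QuaternionGroup 2, (∀ h, h * g = g * h) → g = 1 ∨ g = a 2 := by decide
    rcases H.bot_or_exists_ne_one with h | ⟨g, hg, hg1⟩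
    · exact Or.inl h
    · refine Or.inr (Or.inl (le_antisymm hH fun z hz => ?_))
      have hg2 := (hcenter g (mem_center_iff.1 (hH hg))).resolve_left hg1
      rcases hcenter z (mem_center_iff.1 hz) with rfl | rfl
      · exact one_mem H
      · exact hg2 ▸ hg
  · right; right
    obtain ⟨g, hg, hgc⟩ := SetLike.not_le_iff_exists.1 hH
    have transport (h k : QuaternionGroup 2) (hk : h * k ≠ k * h) : h ∈ H := by
      rw [mem_center_iff, not_forall] at hgc
      obtain ⟨k', hk'⟩ := hgc
      obtain ⟨φ, hφ, -⟩ := exists_mulAut_of_not_commute (Ne.symm hk')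
      obtain ⟨θ, hθ, -⟩ := exists_mulAut_of_not_commute hk
      have := characteristic_iff_le_comap.1 ‹H.Characteristic› (φ.symm.trans θ) hg
      simpa [← hφ, hθ] using this
    rw [eq_top_iff, ← closure_generators, closure_le]
    rintro _ (rfl | rfl)
    · exact transport _ (xa 0) (by decide)
    · exact transport _ (a 1) (by decide)

theorem isUCS : IsUCS 2 (QuaternionGroup 2) := by
  refine ⟨IsPGroup.of_card (n := 3) (by rw [Nat.card_eq_fintype_card, card]; rfl), ?_⟩
  have hset : {H : Subgroup (QuaternionGroup 2) | H.Characteristic} =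
      {⊥, center (QuaternionGroup 2), ⊤} := by
    ext H
    simp only [Set.mem_ofPred_eq, Set.mem_insert_iff, Set.mem_singleton_iff]
    refine ⟨fun _ => eq_of_characteristic H, ?_⟩
    rintro (rfl | rfl | rfl) <;> infer_instance
  have hbot : center (QuaternionGroup 2) ≠ ⊥ := fun h => by
    have : (a 2 : QuaternionGroup 2) ∈ center (QuaternionGroup 2) :=
      mem_center_iff.2 (by decide)
    rw [h, mem_bot] at this
    exact absurd this (by decide)
  have htop : center (QuaternionGroup 2) ≠ ⊤ := fun h => by
    have : (a 1 : QuaternionGroup 2) ∈ center (QuaternionGroup 2) := h ▸ mem_top _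
    exact absurd (mem_center_iff.1 this (xa 0)) (by decide)
  change Nat.card ({H : Subgroup (QuaternionGroup 2) | H.Characteristic} : Set _) = 3
  rw [hset, Nat.card_coe_set_eq, Set.ncard_eq_three]
  exact ⟨_, _, _, hbot.symm, bot_ne_top, htop, rfl⟩

theorem exists_mulAut_lifting (ψ : MulAut (QuaternionGroup 2 ⧸ frattini (QuaternionGroup 2))) :
    ∃ φ : MulAut (QuaternionGroup 2), ∀ g : QuaternionGroup 2,
      ψ (QuotientGroup.mk g) = QuotientGroup.mk (φ g) := by
  let π := QuotientGroup.mk' (frattini (QuaternionGroup 2))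
  have hπ : Function.Surjective π := QuotientGroup.mk'_surjective _
  obtain ⟨x, hx⟩ := hπ (ψ (π (a 1)))
  obtain ⟨y, hy⟩ := hπ (ψ (π (xa 0)))
  have hgen : closure {x, y} = ⊤ := by
    apply frattini_nongenerating
    have hmap : (closure {x, y}).map π = ⊤ := by
      have himage : π '' {x, y} = (ψ.toMonoidHom.comp π) '' {a 1, xa 0} := by
        simp [Set.image_pair, hx, hy]
      rw [MonoidHom.map_closure, himage, ← MonoidHom.map_closure, closure_generators,
        ← MonoidHom.range_eq_map]
      exact MonoidHom.range_eq_top.2 (ψ.surjective.comp hπ)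
    rw [← QuotientGroup.ker_mk' (frattini (QuaternionGroup 2)), ← comap_map_eq]
    exact hmap ▸ comap_top _
  have hxy : x * y ≠ y * x := fun h => by
    have hcomm : ∀ u ∈ ({x, y} : Set (QuaternionGroup 2)), ∀ v ∈ ({x, y} : Set _),
        u * v = v * u := by
      rintro _ (rfl | rfl) _ (rfl | rfl) <;> simp [h]
    have : IsMulCommutative (closure {x, y}) := isMulCommutative_closure hcomm
    have hx : (a 1 : QuaternionGroup 2) ∈ closure {x, y} := hgen ▸ mem_top _
    have hy : (xa 0 : QuaternionGroup 2) ∈ closure {x, y} := hgen ▸ mem_top _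
    have heq : (a 1 : QuaternionGroup 2) * xa 0 = xa 0 * a 1 := setLike_mul_comm hx hy
    exact absurd heq (by decide)
  obtain ⟨φ, hφa, hφx⟩ := exists_mulAut_of_not_commute hxy
  have heq : ψ.toMonoidHom.comp π = π.comp φ.toMonoidHom := by
    apply MonoidHom.eq_of_eqOn_dense (closure_generators 2)
    rintro _ (rfl | rfl)
    · simp [hφa, hx]
    · simp [hφx, hy]
  exact ⟨φ, fun g => DFunLike.congr_fun heq g⟩

end QuaternionGroup

section CenterIndexFour

variable {G : Type*} [Group G] {x y : G}

/-- In a group whose center has index four, the center and two non-commuting elements generate. -/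
theorem eq_top_of_index_center_eq_four (hidx : (center G).index = 4) (hxy : x * y ≠ y * x)
    {L : Subgroup G} (hL : center G ≤ L) (hx : x ∈ L) (hy : y ∈ L) : L = ⊤ := by
  have h1 : center G ≤ L ⊓ centralizer {x} := le_inf hL (center_le_centralizer _)
  have e1 := relIndex_mul_relIndex _ _ _ h1 inf_le_left
  have e2 := relIndex_mul_index hL
  have n1 : (center G).relIndex (L ⊓ centralizer {x}) ≠ 1 := fun h => by
    have := relIndex_eq_one.1 h ⟨hx, mem_centralizer_singleton_iff.2 rfl⟩
    exact hxy (mem_center_iff.1 this y).symm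
  have n2 : (L ⊓ centralizer {x}).relIndex L ≠ 1 := fun h => by
    have := (relIndex_eq_one.1 h hy).2
    exact hxy (mem_centralizer_singleton_iff.1 this).symm
  rw [← index_eq_one]
  rw [hidx, ← e1] at e2
  generalize (center G).relIndex (L ⊓ centralizer {x}) = p at *
  generalize (L ⊓ centralizer {x}).relIndex L = q at *
  generalize L.index = r at *
  have hp : 2 ≤ p := by
    have : p ≠ 0 := by rintro rfl; simp at e2
    lia
  have hq : 2 ≤ q := by
    have : q ≠ 0 := by rintro rfl; simp at e2
    lia
  have hr : r ≠ 0 := by rintro rfl; simp at e2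
  have : 4 ≤ p * q := Nat.mul_le_mul hp hq
  nlinarith [Nat.pos_of_ne_zero hr]

theorem sq_mem_center (hidx : (center G).index = 4) (g : G) : g ^ 2 ∈ center G := by
  by_cases hcomm : ∀ u v : G, u * v = v * u
  · exact mem_center_iff.2 fun h => hcomm _ _
  have hcard : Nat.card (G ⧸ center G) = 4 := hidx
  have hdvd : orderOf (g : G ⧸ center G) ∣ 2 ^ 2 := by
    simpa [hcard] using orderOf_dvd_natCard (g : G ⧸ center G)
  obtain ⟨k, hk, hord⟩ := (Nat.dvd_prime_pow Nat.prime_two).1 hdvd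
  have hk2 : k ≠ 2 := by
    rintro rfl
    have : Finite (G ⧸ center G) := Nat.finite_of_card_ne_zero (by lia)
    have := isCyclic_of_orderOf_eq_card (g : G ⧸ center G) (by rw [hord, hcard]; rfl)
    have := MonoidHom.isMulCommutative_of_isCyclic_of_ker_le_center
      (QuotientGroup.mk' (center G)) (QuotientGroup.ker_mk' _).le
    exact hcomm fun u v => this.is_comm.comm u v
  have : orderOf (g : G ⧸ center G) ∣ 2 := by
    rw [hord]
    exact pow_dvd_pow 2 (by lia : k ≤ 1)
  rw [← QuotientGroup.eq_one_iff]
  exact orderOf_dvd_iff_pow_eq_one.1 this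

open scoped commutatorElement

theorem commutatorElement_sq_eq_one (hidx : (center G).index = 4)
    (hcomm : commutator G ≤ center G) (x y : G) : ⁅x, y⁆ ^ 2 = 1 := by
  have hc : ⁅x, y⁆ ∈ center G := hcomm (commutator_mem_commutator (mem_top _) (mem_top _))
  have hconj : x * y * x⁻¹ = ⁅x, y⁆ * y := by simp [commutatorElement_def]
  have hc' : Commute ⁅x, y⁆ y := ((mem_center_iff.1 hc) y).symm
  have hsq : x * y ^ 2 * x⁻¹ = y ^ 2 := by
    rw [mem_center_iff.1 (sq_mem_center hidx y) x, mul_inv_cancel_right]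
  rw [← conj_pow, hconj, hc'.mul_pow] at hsq
  exact mul_eq_right.1 hsq

theorem commutator_eq_zpowers (hidx : (center G).index = 4)
    (hcomm : commutator G ≤ center G) (hxy : x * y ≠ y * x) :
    commutator G = zpowers ⁅x, y⁆ := by
  have hc : ⁅x, y⁆ ∈ commutator G := commutator_mem_commutator (mem_top _) (mem_top _)
  have hle : zpowers ⁅x, y⁆ ≤ center G := (zpowers_le).2 (hcomm hc)
  have hnormal : (zpowers ⁅x, y⁆).Normal := ⟨fun n hn g => by
    rwa [mem_center_iff.1 (hle hn) g, mul_inv_cancel_right]⟩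
  refine le_antisymm ?_ ((zpowers_le).2 hc)
  let π := QuotientGroup.mk' (zpowers ⁅x, y⁆)
  have hcommute : Commute (π x) (π y) := by
    rw [← commutatorElement_eq_one_iff_commute, ← map_commutatorElement]
    exact (QuotientGroup.eq_one_iff _).2 (mem_zpowers _)
  have hcentral {z : G} (hz : z ∈ center G) (g : G) : Commute (π g) (π z) :=
    Commute.map (mem_center_iff.1 hz g) π
  have hcentralizer (g : G) (h₁ : Commute (π g) (π x)) (h₂ : Commute (π g) (π y)) (h : G) :
      Commute (π g) (π h) := by
    have : (centralizer {π g}).comap π = ⊤ :=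
      eq_top_of_index_center_eq_four hidx hxy
        (fun z hz => mem_centralizer_singleton_iff.2 (hcentral hz g).symm.eq)
        (mem_centralizer_singleton_iff.2 h₁.symm.eq)
        (mem_centralizer_singleton_iff.2 h₂.symm.eq)
    have hmem : h ∈ (centralizer {π g}).comap π := this ▸ mem_top h
    exact Commute.symm (mem_centralizer_singleton_iff.1 hmem)
  have hx := hcentralizer x (Commute.refl _) hcommute
  have hy := hcentralizer y hcommute.symm (Commute.refl _)
  refine commutator_le.2 fun g _ h _ => ?_
  rw [← QuotientGroup.eq_one_iff]
  change π ⁅g, h⁆ = 1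
  rw [map_commutatorElement, commutatorElement_eq_one_iff_commute]
  exact hcentralizer g (hx g).symm (hy g).symm h

end CenterIndexFour

open scoped commutatorElement in
theorem nonempty_mulEquiv_quaternionGroup {G : Type*} [Group G] [Finite G] (hG : IsUCS 2 G)
    (hnc : ¬ ∀ a b : G, a * b = b * a) (hcard : Nat.card (G ⧸ frattini G) = 4) :
    Nonempty (G ≃* QuaternionGroup 2) := by
  obtain ⟨hp, hthree⟩ := hG
  have : Fact (Nat.Prime 2) := ⟨Nat.prime_two⟩
  push Not at hnc
  obtain ⟨u, v, huv⟩ := hnc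
  have hnontriv : Nontrivial G := ⟨_, _, huv⟩
  have hcenter_bot : center G ≠ ⊥ := by
    have := hp.center_nontrivial
    exact (nontrivial_iff_ne_bot _).1 this
  have hcenter_top : center G ≠ ⊤ := fun h =>
    huv (mem_center_iff.1 (h ▸ mem_top v : v ∈ center G) u)
  -- Any characteristic subgroup is trivial, the center, or everything.
  have htri (H : Subgroup G) (hH : H.Characteristic) : H = ⊥ ∨ H = ⊤ ∨ H = center G := by
    change Nat.card ({H : Subgroup G | H.Characteristic} : Set _) = 3 at hthree
    rw [Nat.card_coe_set_eq] at hthree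
    have hsub : ({⊥, center G, ⊤} : Set (Subgroup G)) ⊆ {H : Subgroup G | H.Characteristic} := by
      rintro _ (rfl | rfl | rfl) <;> simp only [Set.mem_ofPred_eq] <;> infer_instance
    have heq := Set.eq_of_subset_of_ncard_le hsub (by
      rw [hthree, Set.ncard_eq_three.2 ⟨_, _, _, hcenter_bot.symm, bot_ne_top, hcenter_top, rfl⟩])
    have : H ∈ ({⊥, center G, ⊤} : Set (Subgroup G)) := heq ▸ hH
    simp only [Set.mem_insert_iff, Set.mem_singleton_iff] at this
    tauto
  have hfrattini : frattini G = center G := by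
    rcases htri (frattini G) inferInstance with h | h | h
    · have hcard' : Nat.card G = 2 ^ 2 := by
        rw [← index_bot, ← h]
        exact hcard
      have := IsPGroup.isMulCommutative_of_card_eq_prime_sq hcard'
      exact absurd (this.is_comm.comm u v) huv
    · have : (frattini G).index = 4 := hcard
      rw [h, index_top] at this
      lia
    · exact h
  have hidx : (center G).index = 4 := hfrattini ▸ hcard
  have hcommutator : commutator G = center G := by
    rcases htri (commutator G) inferInstance with h | h | h
    · have : ⁅u, v⁆ ∈ commutator G := commutator_mem_commutator (mem_top _) (mem_top _)
      rw [h, mem_bot, commutatorElement_eq_one_iff_mul_comm] at this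
      exact absurd this huv
    · have := hp.isNilpotent
      exact absurd h (Group.IsSolvable.commutator_lt_top_of_nontrivial G).ne
    · exact h
  have hcenter {x y : G} (hxy : x * y ≠ y * x) {z : G} (hz : z ∈ center G) :
      z = 1 ∨ z = ⁅x, y⁆ := by
    rw [← hcommutator, commutator_eq_zpowers hidx hcommutator.le hxy] at hz
    obtain ⟨k, rfl⟩ := mem_zpowers_iff.1 hz
    have hsq := commutatorElement_sq_eq_one hidx hcommutator.le x y
    rcases Int.even_or_odd' k with ⟨m, rfl | rfl⟩
    · left; rw [zpow_mul, zpow_ofNat, hsq, one_zpow]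
    · right; rw [zpow_add_one, zpow_mul, zpow_ofNat, hsq, one_zpow, one_mul]
  have hcenter_sq {z : G} (hz : z ∈ center G) : z ^ 2 = 1 := by
    rcases hcenter huv hz with rfl | rfl
    · exact one_pow 2
    · exact commutatorElement_sq_eq_one hidx hcommutator.le u v
  -- The elements whose square is nontrivial generate the group.
  have hclosure : closure {g : G | g ^ 2 ≠ 1} = ⊤ := by
    have hchar : (closure {g : G | g ^ 2 ≠ 1}).Characteristic := by
      refine characteristic_iff_le_comap.2 fun φ => (closure_le _).2 fun g hg => ?_
      refine subset_closure fun h => hg (φ.injective ?_)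
      simpa using h
    have hexists : ∃ g : G, g ^ 2 ≠ 1 := by
      by_contra! h
      have hexp : Monoid.exponent G = 2 := (Nat.prime_two.eq_one_or_self_of_dvd _
        (Monoid.exponent_dvd_of_forall_pow_eq_one h)).resolve_left fun h1 =>
          not_subsingleton G (Monoid.exp_eq_one_iff.1 h1)
      exact huv (mul_comm_of_exponent_two hexp u v)
    obtain ⟨g, hg⟩ := hexists
    have hmem : g ∈ closure {g : G | g ^ 2 ≠ 1} := subset_closure hg
    rcases htri _ hchar with h | h | h
    · rw [h, mem_bot] at hmem
      simp [hmem] at hg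
    · exact h
    · exact absurd (hcenter_sq (h ▸ hmem)) hg
  obtain ⟨x, hx, y, hy, hxy⟩ : ∃ x : G, x ^ 2 ≠ 1 ∧ ∃ y : G, y ^ 2 ≠ 1 ∧ x * y ≠ y * x := by
    by_contra! h
    have : IsMulCommutative (closure {g : G | g ^ 2 ≠ 1}) :=
      isMulCommutative_closure fun x hx y hy => h x hx y hy
    exact huv (setLike_mul_comm (hclosure ▸ mem_top u : u ∈ closure {g : G | g ^ 2 ≠ 1})
      (hclosure ▸ mem_top v))
  have hx2 := (hcenter hxy (sq_mem_center hidx x)).resolve_left hx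
  have hy2 := (hcenter hxy (sq_mem_center hidx y)).resolve_left hy
  have hx4 : x ^ (2 * 2) = 1 := by rw [pow_mul, hcenter_sq (sq_mem_center hidx x)]
  have hrel : y * x = x⁻¹ * y := by
    have hinv : ⁅x, y⁆⁻¹ = ⁅x, y⁆ := by
      rw [inv_eq_iff_mul_eq_one, ← sq]
      exact commutatorElement_sq_eq_one hidx hcommutator.le x y
    have h : y * x = ⁅x, y⁆⁻¹ * (x * y) := by simp [commutatorElement_def, mul_assoc]
    have hxx : x ^ 2 = (x ^ 2)⁻¹ := by rw [hx2, hinv]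
    rw [h, ← hx2]
    group
  have hord : orderOf x = 2 * 2 := orderOf_eq_prime_pow (p := 2) (n := 1) (by simpa using hx) hx4
  let f := QuaternionGroup.lift (n := 2) x y hx4 (by rw [← sq, hx2, hy2]) hrel
  have hinj : Function.Injective f := QuaternionGroup.lift_injective _ _ _ hord hxy
  have hfx : x ∈ f.range := ⟨_, QuaternionGroup.lift_a_one _ _ _⟩
  have hsurj : f.range = ⊤ := by
    refine eq_top_of_index_center_eq_four hidx hxy (fun z hz => ?_) hfx
      ⟨_, QuaternionGroup.lift_xa_zero _ _ _⟩
    rcases hcenter hxy hz with rfl | rfl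
    · exact one_mem _
    · exact hx2 ▸ pow_mem hfx 2
  exact ⟨(MulEquiv.ofBijective f ⟨hinj, MonoidHom.range_eq_top.1 hsurj⟩).symm⟩

theorem stmt3 :
    (∀ (G : Type) [Group G] [Finite G], IsUCS 2 G →
        ¬ (∀ a b : G, a * b = b * a) →
        Nat.card (G ⧸ frattini G) = 4 →
        Nonempty (G ≃* QuaternionGroup 2)) ∧
    IsUCS 2 (QuaternionGroup 2) ∧
    -- the automorphisms of `Q₈` induce the full automorphism group
    -- (that is, `GL₂(F₂)`) on the Frattini quotient of `Q₈`
    (∀ ψ : MulAut (QuaternionGroup 2 ⧸ frattini (QuaternionGroup 2)),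
        ∃ φ : MulAut (QuaternionGroup 2), ∀ g : QuaternionGroup 2,
          ψ (QuotientGroup.mk g) = QuotientGroup.mk (φ g)) := by
  exact ⟨fun _ _ _ hG hnc hcard => nonempty_mulEquiv_quaternionGroup hG hnc hcard,
    QuaternionGroup.isUCS, QuaternionGroup.exists_mulAut_lifting⟩
end

section
/- Let p be an odd prime and let G be a non-abelian UCS p-group minimally generated by 2 elements (equivalently |G/Φ(G)| = p²). Then G is the extraspecial group of order p³ and exponent p; in particular any two such groups are isomorphic. Conversely, the extraspecial group of order p³ and exponent p is a UCS p-group, and the action of its automorphism group on G/Φ(G) induces the full group GL₂(F_p). -/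
/-- `G` is the extraspecial group of order `p³` and exponent `p`:
its commutator subgroup, centre and Frattini subgroup coincide and
have order `p`, `|G| = p³` and `G` has exponent `p`. -/
def IsExtraspecialP3ExpP (p : ℕ) (G : Type*) [Group G] : Prop :=
  Nat.card G = p ^ 3 ∧ Monoid.exponent G = p ∧
    commutator G = Subgroup.center G ∧ Subgroup.center G = frattini G ∧
    Nat.card (frattini G) = p

section NormalForm

variable {G : Type*} [Group G] {x y c : G}

lemma zpow_mul_eq_of_mul_eq (h : x * y = y * x * c) (hcx : Commute c x) (i : ℤ) :
    x ^ i * y = y * x ^ i * c ^ i := by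
  have h1 : SemiconjBy y (x * c) x := by
    simp only [SemiconjBy, h, mul_assoc]
  have h2 := (h1.zpow_right i).eq
  rw [hcx.symm.mul_zpow] at h2
  rw [← h2, mul_assoc]

lemma mul_zpow_eq_of_mul_eq (h : x * y = y * x * c) (hcy : Commute c y) (j : ℤ) :
    x * y ^ j = y ^ j * x * c ^ j := by
  have h' : y * x = x * y * c⁻¹ := by rw [h]; group
  have := zpow_mul_eq_of_mul_eq h' hcy.inv_left j
  rw [this]; group

/-- If the commutator of `x` and `y` commutes with both, every element of the subgroup they
generate has the form `x ^ i * y ^ j * c ^ k`. -/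
lemma exists_zpow_of_mem_closure_pair (h : x * y = y * x * c) (hcx : Commute c x)
    (hcy : Commute c y) {g : G} (hg : g ∈ Subgroup.closure {x, y}) :
    ∃ i j k : ℤ, g = x ^ i * y ^ j * c ^ k := by
  have key (i : ℤ) := zpow_mul_eq_of_mul_eq h hcx i
  have cy (k j : ℤ) : c ^ k * y ^ j = y ^ j * c ^ k := (hcy.zpow_zpow k j).eq
  have hy (i : ℤ) : y * x ^ i = x ^ i * y * c ^ (-i) := by rw [key]; group
  have hy' (i : ℤ) : y⁻¹ * x ^ i = x ^ i * y⁻¹ * c ^ i := by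
    rw [inv_mul_eq_iff_eq_mul, ← mul_assoc, ← mul_assoc, hy, mul_assoc (x ^ i * y),
      ← zpow_neg_one y, cy, mul_assoc, mul_assoc (y ^ (-1 : ℤ))]
    group
  induction hg using Subgroup.closure_induction_left with
  | one => exact ⟨0, 0, 0, by simp⟩
  | mul_left a ha b _ ih =>
    obtain ⟨i, j, k, rfl⟩ := ih
    rcases ha with rfl | rfl
    · exact ⟨1 + i, j, k, by rw [zpow_add, zpow_one]; simp only [mul_assoc]⟩
    · refine ⟨i, 1 + j, -i + k, ?_⟩
      rw [← mul_assoc, ← mul_assoc, hy, mul_assoc (x ^ i * a), cy, zpow_add, zpow_add, zpow_one]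
      simp only [mul_assoc]
  | inv_mul_cancel a ha b _ ih =>
    obtain ⟨i, j, k, rfl⟩ := ih
    rcases ha with rfl | rfl
    · exact ⟨-1 + i, j, k, by rw [zpow_add, zpow_neg_one]; simp only [mul_assoc]⟩
    · refine ⟨i, -1 + j, i + k, ?_⟩
      rw [← mul_assoc, ← mul_assoc, hy', mul_assoc (x ^ i * a⁻¹), cy, zpow_add, zpow_add,
        zpow_neg_one]
      simp only [mul_assoc]

lemma mul_pow_of_mul_eq (h : y * x = x * y * c) (hcx : Commute c x) (hcy : Commute c y) (n : ℕ) :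
    (x * y) ^ n = x ^ n * y ^ n * c ^ n.choose 2 := by
  induction n with
  | zero => simp
  | succ n ih =>
    have h1 := zpow_mul_eq_of_mul_eq h hcy n
    simp only [zpow_natCast] at h1
    have h2 : Commute (c ^ n.choose 2) (x * y) := (hcx.mul_right hcy).pow_left _
    rw [pow_succ, ih, mul_assoc, h2.eq, ← mul_assoc, ← mul_assoc, mul_assoc (x ^ n), h1,
      pow_succ x, pow_succ y, Nat.choose_succ_succ' n 1, Nat.choose_one_right, pow_add]
    simp only [mul_assoc]
    rw [← mul_assoc (c ^ n) y, (hcy.pow_left n).eq, mul_assoc]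

lemma zpow_eq_one_of_mul_eq_one (h : x * y = y * x * c) (hcx : Commute c x) (hcy : Commute c y)
    (hne : c ≠ 1) {p : ℕ} (hp : p.Prime) (hexp : ∀ g : G, g ^ p = 1) {i j k : ℤ}
    (h1 : x ^ i * y ^ j * c ^ k = 1) : (p : ℤ) ∣ i ∧ (p : ℤ) ∣ j ∧ (p : ℤ) ∣ k := by
  have := Fact.mk hp
  have hc : orderOf c = p := orderOf_eq_prime (hexp c) hne
  have hdvd (m : ℤ) : c ^ m = 1 → (p : ℤ) ∣ m := fun hm => by
    rw [← hc]; exact orderOf_dvd_iff_zpow_eq_one.mpr hm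
  have hpow (g : G) (m : ℤ) (hm : (p : ℤ) ∣ m) : g ^ m = 1 := by
    obtain ⟨n, rfl⟩ := hm
    rw [zpow_mul, zpow_natCast, hexp, one_zpow]
  have hi : (p : ℤ) ∣ i := by
    apply hdvd
    have hxy : Commute (x ^ i) y := by
      rw [mul_assoc] at h1
      rw [eq_inv_of_mul_eq_one_left h1]
      exact (((Commute.refl y).zpow_left j).mul_left (hcy.zpow_left k)).inv_left
    have := zpow_mul_eq_of_mul_eq h hcx i
    rw [hxy.eq] at this
    exact left_eq_mul.mp this
  rw [hpow x i hi, one_mul] at h1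
  have hj : (p : ℤ) ∣ j := by
    apply hdvd
    have hxy : Commute x (y ^ j) := by
      rw [eq_inv_of_mul_eq_one_left h1]
      exact (hcx.symm.zpow_right k).inv_right
    have := mul_zpow_eq_of_mul_eq h hcy j
    rw [hxy.eq] at this
    exact left_eq_mul.mp this
  rw [hpow y j hj, one_mul] at h1
  exact ⟨hi, hj, hdvd k h1⟩

end NormalForm

lemma Subgroup.eq_top_of_not_commute {G : Type*} [Group G] {p : ℕ} (hp : p.Prime)
    (hcard : Nat.card G = p ^ 3) {K : Subgroup G} {x y : G} (hx : x ∈ K) (hy : y ∈ K)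
    (hxy : x * y ≠ y * x) : K = ⊤ := by
  have := Fact.mk hp
  have : Finite G := Nat.finite_of_card_ne_zero (by rw [hcard]; exact (pow_pos hp.pos 3).ne')
  have hne : ¬ ∀ a b : K, a * b = b * a := fun h => hxy (congrArg Subtype.val (h ⟨x, hx⟩ ⟨y, hy⟩))
  obtain ⟨n, hn, hK⟩ := (Nat.dvd_prime_pow hp).mp (hcard ▸ K.card_subgroup_dvd_card)
  apply Subgroup.eq_top_of_card_eq
  rw [hK, hcard]
  interval_cases n
  · rw [pow_zero, Nat.card_eq_one_iff_unique] at hK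
    have := hK.1
    exact (hne fun a b => Subsingleton.elim _ _).elim
  · rw [pow_one] at hK
    have := isCyclic_of_prime_card hK
    exact (hne (IsCyclic.commGroup (α := K)).mul_comm).elim
  · exact (hne (IsPGroup.commGroupOfCardEqPrimeSq hK).mul_comm).elim
  · rfl

open scoped commutatorElement in
lemma exists_mul_eq_of_commutator_le_center {G : Type*} [Group G]
    (h : commutator G ≤ Subgroup.center G) (x y : G) :
    ∃ c ∈ commutator G, (∀ g, Commute c g) ∧ x * y = y * x * c := by
  have hc : ⁅x⁻¹, y⁻¹⁆ ∈ commutator G :=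
    Subgroup.commutator_mem_commutator (Subgroup.mem_top _) (Subgroup.mem_top _)
  refine ⟨⁅x⁻¹, y⁻¹⁆, hc, fun g => (Subgroup.mem_center_iff.mp (h hc) g).symm, ?_⟩
  rw [commutatorElement_def]; group

/-- In groups of order `p ^ 3`, exponent `p` and class two, any pair of non-commuting elements
can be mapped to any other by an isomorphism. -/
lemma exists_mulEquiv_of_not_commute {G H : Type*} [Group G] [Group H] {p : ℕ} (hp : p.Prime)
    (hG : Nat.card G = p ^ 3) (hH : Nat.card H = p ^ 3)
    (eG : ∀ g : G, g ^ p = 1) (eH : ∀ h : H, h ^ p = 1)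
    (cG : commutator G ≤ Subgroup.center G) (cH : commutator H ≤ Subgroup.center H)
    {x y : G} (hxy : x * y ≠ y * x) {x' y' : H} (hxy' : x' * y' ≠ y' * x') :
    ∃ e : G ≃* H, e x = x' ∧ e y = y' := by
  obtain ⟨c, -, hc, h⟩ := exists_mul_eq_of_commutator_le_center cG x y
  obtain ⟨c', -, hc', h'⟩ := exists_mul_eq_of_commutator_le_center cH x' y'
  have hne : c ≠ 1 := by rintro rfl; exact hxy (by simpa using h)
  have hne' : c' ≠ 1 := by rintro rfl; exact hxy' (by simpa using h')
  set D : Subgroup (G × H) := Subgroup.closure {(x, x'), (y, y')}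
  have hX : (x, x') ∈ D := Subgroup.subset_closure (by simp)
  have hY : (y, y') ∈ D := Subgroup.subset_closure (by simp)
  have nf {d : G × H} (hd : d ∈ D) :
      ∃ i j k : ℤ, d = (x, x') ^ i * (y, y') ^ j * (c, c') ^ k :=
    exists_zpow_of_mem_closure_pair (Prod.ext h h') ((hc x).prod (hc' x'))
      ((hc y).prod (hc' y')) hd
  have hpow (g : G × H) (m : ℤ) (hm : (p : ℤ) ∣ m) : g ^ m = 1 := by
    obtain ⟨n, rfl⟩ := hm
    rw [zpow_mul, zpow_natCast, show g ^ p = 1 from Prod.ext (eG _) (eH _), one_zpow]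
  let f₁ : D →* G := (MonoidHom.fst G H).comp D.subtype
  let f₂ : D →* H := (MonoidHom.snd G H).comp D.subtype
  have b₁ : Function.Bijective f₁ := by
    constructor
    · refine (injective_iff_map_eq_one f₁).mpr fun ⟨d, hd⟩ hd1 => ?_
      obtain ⟨i, j, k, rfl⟩ := nf hd
      obtain ⟨hi, hj, hk⟩ := zpow_eq_one_of_mul_eq_one h (hc x) (hc y) hne hp eG hd1
      refine Subtype.ext ?_
      change (x, x') ^ i * (y, y') ^ j * (c, c') ^ k = 1
      rw [hpow _ _ hi, hpow _ _ hj, hpow _ _ hk, one_mul, one_mul]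
    · exact MonoidHom.range_eq_top.mp <| Subgroup.eq_top_of_not_commute hp hG
        ⟨⟨_, hX⟩, rfl⟩ ⟨⟨_, hY⟩, rfl⟩ hxy
  have b₂ : Function.Bijective f₂ := by
    constructor
    · refine (injective_iff_map_eq_one f₂).mpr fun ⟨d, hd⟩ hd1 => ?_
      obtain ⟨i, j, k, rfl⟩ := nf hd
      obtain ⟨hi, hj, hk⟩ := zpow_eq_one_of_mul_eq_one h' (hc' x') (hc' y') hne' hp eH hd1
      refine Subtype.ext ?_
      change (x, x') ^ i * (y, y') ^ j * (c, c') ^ k = 1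
      rw [hpow _ _ hi, hpow _ _ hj, hpow _ _ hk, one_mul, one_mul]
    · exact MonoidHom.range_eq_top.mp <| Subgroup.eq_top_of_not_commute hp hH
        ⟨⟨_, hX⟩, rfl⟩ ⟨⟨_, hY⟩, rfl⟩ hxy'
  refine ⟨(MulEquiv.ofBijective f₁ b₁).symm.trans (MulEquiv.ofBijective f₂ b₂), ?_, ?_⟩
  · have : (MulEquiv.ofBijective f₁ b₁).symm x = ⟨_, hX⟩ := by
      rw [MulEquiv.symm_apply_eq]; rfl
    rw [MulEquiv.trans_apply, this]; rfl
  · have : (MulEquiv.ofBijective f₁ b₁).symm y = ⟨_, hY⟩ := by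
      rw [MulEquiv.symm_apply_eq]; rfl
    rw [MulEquiv.trans_apply, this]; rfl

namespace IsExtraspecialP3ExpP

variable {p : ℕ} {G : Type*} [Group G]

lemma pow_eq_one (hG : IsExtraspecialP3ExpP p G) (g : G) : g ^ p = 1 := by
  have := Monoid.pow_exponent_eq_one g
  rwa [hG.2.1] at this

lemma center_ne_top (hp : p.Prime) (hG : IsExtraspecialP3ExpP p G) :
    Subgroup.center G ≠ ⊤ := fun h => by
  obtain ⟨h1, -, -, h4, h5⟩ := hG
  rw [← h4, h, Subgroup.card_top, h1] at h5
  exact absurd (Nat.pow_right_injective hp.two_le (h5.trans (pow_one p).symm)) (by norm_num)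

lemma center_ne_bot (hp : p.Prime) (hG : IsExtraspecialP3ExpP p G) :
    Subgroup.center G ≠ ⊥ := fun h => by
  obtain ⟨-, -, -, h4, h5⟩ := hG
  rw [← h4, h, Subgroup.card_bot] at h5
  exact hp.one_lt.ne h5

lemma characteristic_iff (hp : p.Prime) (hG : IsExtraspecialP3ExpP p G) (K : Subgroup G) :
    K.Characteristic ↔ K = ⊥ ∨ K = Subgroup.center G ∨ K = ⊤ := by
  constructor
  · intro hK
    by_cases hle : K ≤ Subgroup.center G
    · obtain hz : Nat.card (Subgroup.center G) = p := hG.2.2.2.1 ▸ hG.2.2.2.2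
      have : Finite (Subgroup.center G) :=
        Nat.finite_of_card_ne_zero (by rw [hz]; exact hp.ne_zero)
      rcases (Nat.dvd_prime hp).mp (hz ▸ Subgroup.card_dvd_of_le hle) with h | h
      · exact Or.inl (Subgroup.card_eq_one.mp h)
      · exact Or.inr (Or.inl (Subgroup.eq_of_le_of_card_ge hle (by rw [h, hz])))
    · right; right
      obtain ⟨a, haK, ha⟩ := SetLike.not_le_iff_exists.mp hle
      have hout (b : G) (hb : b ∉ Subgroup.center G) : b ∈ K := by
        simp only [Subgroup.mem_center_iff, not_forall] at ha hb
        obtain ⟨a', ha⟩ := ha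
        obtain ⟨b', hb⟩ := hb
        obtain ⟨e, he, -⟩ := exists_mulEquiv_of_not_commute hp hG.1 hG.1 hG.pow_eq_one
          hG.pow_eq_one hG.2.2.1.le hG.2.2.1.le (Ne.symm ha) (Ne.symm hb)
        exact he ▸ Subgroup.characteristic_iff_le_comap.mp hK e haK
      refine eq_top_iff.mpr fun b _ => ?_
      by_cases hb : b ∈ Subgroup.center G
      · have hab : a * b ∈ K := hout _ fun h => ha ((Subgroup.mul_mem_cancel_right _ hb).mp h)
        exact (Subgroup.mul_mem_cancel_left _ haK).mp hab
      · exact hout b hb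
  · rintro (rfl | rfl | rfl) <;> infer_instance

lemma isUCS (hp : p.Prime) (hG : IsExtraspecialP3ExpP p G) : IsUCS p G := by
  refine ⟨fun g => ⟨1, by rw [pow_one]; exact hG.pow_eq_one g⟩, ?_⟩
  have hS : {K : Subgroup G | K.Characteristic} = {⊥, Subgroup.center G, ⊤} :=
    Set.ext fun K => hG.characteristic_iff hp K
  change Nat.card {K : Subgroup G | K.Characteristic} = 3
  rw [hS, Nat.card_coe_set_eq, Set.ncard_eq_three]
  refine ⟨_, _, _, (hG.center_ne_bot hp).symm, fun h => ?_, hG.center_ne_top hp, rfl⟩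
  exact hG.center_ne_top hp (top_le_iff.mp (h ▸ bot_le))

/-- Every automorphism of the Frattini quotient lifts. -/
lemma exists_lift (hp : p.Prime) (hG : IsExtraspecialP3ExpP p G) (ψ : MulAut (G ⧸ frattini G)) :
    ∃ φ : MulAut G, ∀ g : G, ψ (QuotientGroup.mk g) = QuotientGroup.mk (φ g) := by
  have hcz := hG.2.2.1
  have hcf : commutator G = frattini G := hcz.trans hG.2.2.2.1
  obtain ⟨x, hx⟩ : ∃ x, x ∉ Subgroup.center G := by
    by_contra! h
    exact hG.center_ne_top hp (eq_top_iff.mpr fun a _ => h a)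
  simp only [Subgroup.mem_center_iff, not_forall] at hx
  obtain ⟨y, hyx⟩ := hx
  have hxy : x * y ≠ y * x := Ne.symm hyx
  obtain ⟨c, hc, hcc, h⟩ := exists_mul_eq_of_commutator_le_center hcz.le x y
  have nf (g : G) : ∃ i j k : ℤ, g = x ^ i * y ^ j * c ^ k := by
    apply exists_zpow_of_mem_closure_pair h (hcc x) (hcc y)
    rw [Subgroup.eq_top_of_not_commute hp hG.1 (Subgroup.subset_closure (by simp))
      (Subgroup.subset_closure (by simp)) hxy]
    exact Subgroup.mem_top g
  obtain ⟨x', hx'⟩ := QuotientGroup.mk_surjective (ψ (x : G ⧸ frattini G))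
  obtain ⟨y', hy'⟩ := QuotientGroup.mk_surjective (ψ (y : G ⧸ frattini G))
  have hψ (i j k : ℤ) : ψ ((x ^ i * y ^ j * c ^ k : G) : G ⧸ frattini G) =
      ((x' ^ i * y' ^ j : G) : G ⧸ frattini G) := by
    have hc1 : ((c : G) : G ⧸ frattini G) = 1 := (QuotientGroup.eq_one_iff c).mpr (hcf ▸ hc)
    simp only [QuotientGroup.mk_mul, QuotientGroup.mk_zpow, map_mul, map_zpow, hc1, hx', hy',
      one_zpow, mul_one]
  have hxy' : x' * y' ≠ y' * x' := by
    intro hcomm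
    have nf' (g : G) : ∃ i j : ℤ, ∃ z ∈ Subgroup.center G, g = x' ^ i * y' ^ j * z := by
      obtain ⟨q, hq⟩ := ψ.surjective (g : G ⧸ frattini G)
      obtain ⟨g₀, rfl⟩ := QuotientGroup.mk_surjective q
      obtain ⟨i, j, k, rfl⟩ := nf g₀
      rw [hψ, QuotientGroup.eq] at hq
      exact ⟨i, j, _, hG.2.2.2.1 ▸ hq, by group⟩
    have hZ (z : G) (hz : z ∈ Subgroup.center G) (g : G) : Commute z g :=
      (Subgroup.mem_center_iff.mp hz g).symm
    have hxy'c : Commute x' y' := hcomm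
    have hx'z (g : G) : Commute x' g := by
      obtain ⟨i, j, z, hz, rfl⟩ := nf' g
      exact (((Commute.refl x').zpow_right i).mul_right (hxy'c.zpow_right j)).mul_right
        (hZ z hz x').symm
    have hy'z (g : G) : Commute y' g := by
      obtain ⟨i, j, z, hz, rfl⟩ := nf' g
      exact ((hxy'c.symm.zpow_right i).mul_right ((Commute.refl y').zpow_right j)).mul_right
        (hZ z hz y').symm
    obtain ⟨i, j, z, hz, hxe⟩ := nf' x
    refine hxy (?_ : Commute x y).eq
    rw [hxe]
    exact (((hx'z y).zpow_left i).mul_left ((hy'z y).zpow_left j)).mul_left (hZ z hz y)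
  obtain ⟨φ, hφx, hφy⟩ := exists_mulEquiv_of_not_commute hp hG.1 hG.1 hG.pow_eq_one
    hG.pow_eq_one hcz.le hcz.le hxy hxy'
  refine ⟨φ, fun g => ?_⟩
  obtain ⟨i, j, k, rfl⟩ := nf g
  have hφc : ((φ c : G) : G ⧸ frattini G) = 1 := by
    rw [QuotientGroup.eq_one_iff, ← hcf]
    exact Subgroup.characteristic_iff_le_comap.mp inferInstance φ hc
  rw [hψ]
  simp only [map_mul, map_zpow, hφx, hφy, QuotientGroup.mk_mul, QuotientGroup.mk_zpow, hφc,
    one_zpow, mul_one]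

end IsExtraspecialP3ExpP

namespace IsUCS

variable {p : ℕ} {G : Type*} [Group G]

lemma eq_of_characteristic (hG : IsUCS p G) {A B : Subgroup G} (hA : A.Characteristic)
    (hB : B.Characteristic) (hA0 : A ≠ ⊥) (hA1 : A ≠ ⊤) (hB0 : B ≠ ⊥) (hB1 : B ≠ ⊤) : A = B := by
  by_contra hAB
  have h3 : ({K : Subgroup G | K.Characteristic}).ncard = 3 := hG.2
  have hbt : (⊥ : Subgroup G) ≠ ⊤ := fun h => hA1 (top_le_iff.mp (h ▸ bot_le))
  have hsub : ({⊥, ⊤, A, B} : Set (Subgroup G)) ⊆ {K | K.Characteristic} := by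
    rintro K (rfl | rfl | rfl | rfl)
    · exact Subgroup.botCharacteristic
    · exact Subgroup.topCharacteristic
    · exact hA
    · exact hB
  have hle := Set.ncard_le_ncard hsub (Set.finite_of_ncard_ne_zero (by rw [h3]; norm_num))
  rw [Set.ncard_insert_of_notMem (by simp [hbt, hA0.symm, hB0.symm]),
    Set.ncard_insert_of_notMem (by simp [hA1.symm, hB1.symm]), Set.ncard_pair hAB, h3] at hle
  omega

lemma isExtraspecialP3ExpP [Finite G] (hp : p.Prime) (hodd : Odd p) (hG : IsUCS p G)
    (hna : ¬ ∀ a b : G, a * b = b * a) (hcard : Nat.card (G ⧸ frattini G) = p ^ 2) :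
    IsExtraspecialP3ExpP p G := by
  have := Fact.mk hp
  have : Nontrivial G := by
    by_contra h
    rw [not_nontrivial_iff_subsingleton] at h
    exact hna fun a b => Subsingleton.elim _ _
  have : Group.IsNilpotent G := hG.1.isNilpotent
  have hcardG : Nat.card G = p ^ 2 * Nat.card (frattini G) := by
    rw [Subgroup.card_eq_card_quotient_mul_card_subgroup (frattini G), hcard]
  have z0 : Subgroup.center G ≠ ⊥ := by
    have := hG.1.center_nontrivial
    exact (Subgroup.nontrivial_iff_ne_bot _).mp this
  have z1 : Subgroup.center G ≠ ⊤ := fun h =>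
    hna fun a b => Subgroup.mem_center_iff.mp (h ▸ Subgroup.mem_top b) a
  have c0 : commutator G ≠ ⊥ := fun h => z1 ((commutator_eq_bot_iff_center_eq_top G).mp h)
  have c1 : commutator G ≠ ⊤ := by
    have : Group.IsSolvable G := inferInstance
    exact (Group.IsSolvable.commutator_lt_top_of_nontrivial G).ne
  have f1 : frattini G ≠ ⊤ := fun h => by
    rw [h, Subgroup.card_top] at hcardG
    have : 1 < p ^ 2 := Nat.one_lt_pow two_ne_zero hp.one_lt
    have h0 : 0 < Nat.card G := Nat.card_pos
    nlinarith
  have f0 : frattini G ≠ ⊥ := fun h => by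
    rw [h, Subgroup.card_bot, mul_one] at hcardG
    exact hna (IsPGroup.commGroupOfCardEqPrimeSq hcardG).mul_comm
  have hcz : commutator G = Subgroup.center G :=
    hG.eq_of_characteristic inferInstance inferInstance c0 c1 z0 z1
  have hzf : Subgroup.center G = frattini G :=
    hG.eq_of_characteristic inferInstance inferInstance z0 z1 f0 f1
  have hZ {z : G} (hz : z ∈ Subgroup.center G) (g : G) : Commute z g :=
    (Subgroup.mem_center_iff.mp hz g).symm
  have hcardZ : Nat.card (G ⧸ Subgroup.center G) = p ^ 2 := by rw [hzf, hcard]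
  have hpz (g : G) : g ^ p ∈ Subgroup.center G := by
    rw [← QuotientGroup.eq_one_iff, QuotientGroup.mk_pow]
    obtain ⟨n, hn, ho⟩ := (Nat.dvd_prime_pow hp).mp
      (hcardZ ▸ orderOf_dvd_natCard (g : G ⧸ Subgroup.center G))
    rw [← orderOf_dvd_iff_pow_eq_one, ho]
    interval_cases n
    · simp
    · simp
    · have : IsCyclic (G ⧸ Subgroup.center G) :=
        isCyclic_of_orderOf_eq_card _ (ho.trans hcardZ.symm)
      exact (hna (MonoidHom.isMulCommutative_of_isCyclic_of_ker_le_center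
        (QuotientGroup.mk' (Subgroup.center G))
        (by rw [QuotientGroup.ker_mk'])).is_comm.comm).elim
  obtain ⟨x, y, hxy⟩ : ∃ x y : G, x * y ≠ y * x := by simpa only [not_forall] using hna
  obtain ⟨c, hc, hcc, h⟩ := exists_mul_eq_of_commutator_le_center hcz.le x y
  have hc1 : c ≠ 1 := by rintro rfl; exact hxy (by simpa using h)
  have hcp : c ^ p = 1 := by
    have := zpow_mul_eq_of_mul_eq h (hcc x) p
    rw [zpow_natCast, zpow_natCast, (hZ (hpz x) y).eq] at this
    exact left_eq_mul.mp this
  have hgen : Subgroup.closure {x, y} = ⊤ := by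
    apply frattini_nongenerating
    rw [← hzf]
    set K := Subgroup.closure {x, y} ⊔ Subgroup.center G
    have hxK : x ∈ K := Subgroup.mem_sup_left (Subgroup.subset_closure (by simp))
    have hyK : y ∈ K := Subgroup.mem_sup_left (Subgroup.subset_closure (by simp))
    set C := Subgroup.centralizer {x} ⊓ K
    have hZC : Subgroup.center G ≤ C :=
      le_inf (Subgroup.center_le_centralizer _) le_sup_right
    have hCK : C ≤ K := inf_le_right
    have m1 := Subgroup.relIndex_mul_relIndex _ _ _ hZC hCK
    have m2 := Subgroup.relIndex_mul_index (hZC.trans hCK)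
    have r1 : (Subgroup.center G).relIndex C ≠ 1 := fun h1 => by
      rw [Subgroup.relIndex_eq_one] at h1
      have hx : x ∈ C := ⟨Subgroup.mem_centralizer_singleton_iff.mpr rfl, hxK⟩
      exact hxy (hZ (h1 hx) y).eq
    have r2 : C.relIndex K ≠ 1 := fun h1 => by
      rw [Subgroup.relIndex_eq_one] at h1
      exact hxy (Subgroup.mem_centralizer_singleton_iff.mp (h1 hyK).1).symm
    rw [← Subgroup.index_eq_one]
    rw [← m1, show (Subgroup.center G).index = p ^ 2 from hcardZ] at m2
    obtain ⟨a, -, ha⟩ := (Nat.dvd_prime_pow hp).mp (Dvd.intro _ ((mul_assoc _ _ _).symm.trans m2))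
    obtain ⟨b, -, hb⟩ := (Nat.dvd_prime_pow hp).mp
      (Dvd.intro_left ((Subgroup.center G).relIndex C * K.index)
        ((mul_right_comm _ _ _).trans m2))
    obtain ⟨d, -, hd⟩ := (Nat.dvd_prime_pow hp).mp (Dvd.intro_left _ m2)
    rw [ha, hb, hd, ← pow_add, ← pow_add] at m2
    have := Nat.pow_right_injective hp.two_le m2
    have ha0 : a ≠ 0 := by rintro rfl; exact r1 (by simpa using ha)
    have hb0 : b ≠ 0 := by rintro rfl; exact r2 (by simpa using hb)
    have hd0 : d = 0 := by omega
    rw [hd, hd0, pow_zero]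
  have hcle : commutator G ≤ Subgroup.zpowers c := by
    have : (Subgroup.zpowers c).Normal := ⟨fun n hn g => by
      obtain ⟨k, rfl⟩ := hn
      have : Commute (c ^ k) g := (hcc g).zpow_left k
      simpa only [← this.eq, mul_inv_cancel_right] using Subgroup.zpow_mem_zpowers c k⟩
    have hcq : ((c : G) : G ⧸ Subgroup.zpowers c) = 1 :=
      (QuotientGroup.eq_one_iff c).mpr (Subgroup.mem_zpowers c)
    have hq : Commute (x : G ⧸ Subgroup.zpowers c) (y : G ⧸ Subgroup.zpowers c) := by
      have := congrArg (QuotientGroup.mk (s := Subgroup.zpowers c)) h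
      rwa [QuotientGroup.mk_mul, QuotientGroup.mk_mul, QuotientGroup.mk_mul, hcq, mul_one] at this
    have nf (g : G) : ∃ i j : ℤ, (g : G ⧸ Subgroup.zpowers c) = (x : G ⧸ Subgroup.zpowers c) ^ i *
        (y : G ⧸ Subgroup.zpowers c) ^ j := by
      obtain ⟨i, j, k, rfl⟩ := exists_zpow_of_mem_closure_pair h (hcc x) (hcc y)
        (hgen ▸ Subgroup.mem_top g)
      exact ⟨i, j, by simp only [QuotientGroup.mk_mul, QuotientGroup.mk_zpow, hcq, one_zpow,
        mul_one]⟩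
    rw [commutator_def, Subgroup.commutator_le]
    intro g₁ _ g₂ _
    rw [← QuotientGroup.eq_one_iff, ← QuotientGroup.mk'_apply, map_commutatorElement,
      commutatorElement_eq_one_iff_commute]
    obtain ⟨i, j, h₁⟩ := nf g₁
    obtain ⟨k, l, h₂⟩ := nf g₂
    rw [QuotientGroup.mk'_apply, QuotientGroup.mk'_apply, h₁, h₂]
    exact ((((Commute.refl _).zpow_zpow i k).mul_right (hq.zpow_zpow i l)).mul_left
      ((hq.symm.zpow_zpow j k).mul_right ((Commute.refl _).zpow_zpow j l)))
  have hcardC : Nat.card (commutator G) = p := by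
    rw [le_antisymm hcle ((Subgroup.zpowers_le).mpr hc), Nat.card_zpowers]
    exact orderOf_eq_prime hcp hc1
  have hcardF : Nat.card (frattini G) = p := by rw [← hzf, ← hcz, hcardC]
  have hG3 : Nat.card G = p ^ 3 := by rw [hcardG, hcardF]; ring
  refine ⟨hG3, ?_, hcz, hzf, hcardF⟩
  let P : G →* G :=
    { toFun := fun g => g ^ p
      map_one' := one_pow p
      map_mul' := fun a b => by
        obtain ⟨e, he, hee, hab⟩ := exists_mul_eq_of_commutator_le_center hcz.le b a
        have hep : e ^ p = 1 := by
          have := pow_card_eq_one' (x := (⟨e, he⟩ : commutator G))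
          rw [hcardC] at this
          exact congrArg Subtype.val this
        obtain ⟨m, hm⟩ := hp.dvd_choose_self two_ne_zero
          (lt_of_le_of_ne hp.two_le (by rintro rfl; exact absurd hodd (by decide)))
        rw [mul_pow_of_mul_eq hab (hee a) (hee b), hm, pow_mul, hep, one_pow, mul_one] }
  have hker : P.ker.Characteristic := by
    refine Subgroup.characteristic_iff_le_comap.mpr fun φ g hg => ?_
    change (φ g) ^ p = 1
    rw [← map_pow, show g ^ p = 1 from hg, map_one]
  have hrange : Nat.card P.range ≤ p := by
    refine (Subgroup.card_le_of_le (K := frattini G) ?_).trans hcardF.le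
    rintro _ ⟨g, rfl⟩
    exact hzf ▸ hpz g
  have hprod : Nat.card P.ker * Nat.card P.range = p ^ 3 := by
    rw [← Subgroup.index_ker, Subgroup.card_mul_index, hG3]
  have hkt : P.ker = ⊤ := by
    by_contra hkt
    have hkp : Nat.card P.ker ≤ p := by
      by_cases hk0 : P.ker = ⊥
      · rw [hk0, Subgroup.card_bot]; exact hp.one_lt.le
      · rw [hG.eq_of_characteristic hker inferInstance hk0 hkt f0 f1, hcardF]
    have h1 := Nat.mul_le_mul hkp hrange
    rw [hprod] at h1
    have h2 := hp.two_le
    have h3 : p ^ 3 = p * p * p := by ring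
    nlinarith
  refine (Nat.dvd_prime hp).mp (Monoid.exponent_dvd_of_forall_pow_eq_one fun g => ?_)
    |>.resolve_left fun h1 => ?_
  · exact (hkt ▸ Subgroup.mem_top g : g ∈ P.ker)
  · exact not_subsingleton G (Monoid.exp_eq_one_iff.mp h1)

end IsUCS

theorem stmt4 (p : ℕ) (hp : p.Prime) (hodd : Odd p) :
    (∀ (G : Type) [Group G] [Finite G], IsUCS p G →
        ¬ (∀ a b : G, a * b = b * a) →
        Nat.card (G ⧸ frattini G) = p ^ 2 →
        IsExtraspecialP3ExpP p G) ∧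
    -- any two extraspecial groups of order `p³` and exponent `p` are isomorphic
    (∀ (G H : Type) [Group G] [Group H],
        IsExtraspecialP3ExpP p G → IsExtraspecialP3ExpP p H →
        Nonempty (G ≃* H)) ∧
    -- conversely, such a group is a UCS `p`-group whose automorphism group
    -- induces the full automorphism group (that is, `GL₂(F_p)`) on the
    -- Frattini quotient
    (∀ (G : Type) [Group G] [Finite G], IsExtraspecialP3ExpP p G →
        IsUCS p G ∧
        ∀ ψ : MulAut (G ⧸ frattini G), ∃ φ : MulAut G, ∀ g : G,
          ψ (QuotientGroup.mk g) = QuotientGroup.mk (φ g)) := by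
  refine ⟨fun G _ _ hG hna hcard => hG.isExtraspecialP3ExpP hp hodd hna hcard, ?_,
    fun G _ _ hG => ⟨hG.isUCS hp, hG.exists_lift hp⟩⟩
  intro G H _ _ hG hH
  have not_comm {K : Type} [Group K] (hK : IsExtraspecialP3ExpP p K) :
      ∃ x y : K, x * y ≠ y * x := by
    by_contra! h
    exact hK.center_ne_top hp
      (eq_top_iff.mpr fun a _ => Subgroup.mem_center_iff.mpr fun b => h b a)
  obtain ⟨x, y, hxy⟩ := not_comm hG
  obtain ⟨x', y', hxy'⟩ := not_comm hH
  obtain ⟨e, -⟩ := exists_mulEquiv_of_not_commute hp hG.1 hH.1 hG.pow_eq_one hH.pow_eq_one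
    hG.2.2.1.le hH.2.2.1.le hxy hxy'
  exact ⟨e⟩
end

section
/- Let F be a finite field of characteristic different from 2, let V be a 3-dimensional F-vector space with basis e₁, e₂, e₃, and let GL(V) act on V ⊕ Λ²V diagonally, with the natural action on V and the exterior square action on Λ²V. Let U be a 3-dimensional subspace of V ⊕ Λ²V with U ∩ V = 0 and U ∩ Λ²V = 0, and suppose the setwise stabilizer GL(V)_U acts irreducibly on V. Let W = ⟨e₁ − e₂∧e₃, e₂ − e₃∧e₁, e₃ − e₁∧e₂⟩. Then there exists g ∈ GL(V) with Ug = W (so GL(V)_U = g·GL(V)_W·g⁻¹), and the stabilizer GL(V)_W equals the special orthogonal group SO₃(F) = {g ∈ GL₃(F) : g·gᵀ = I and det(g) = 1} (matrices taken with respect to the basis e₁, e₂, e₃). -/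
open Matrix

noncomputable section

variable (F : Type) [Field F]

/-- The diagonal action of `g ∈ GL₃(F)` on `V ⊕ Λ²V`, written in the basis
`e₁, e₂, e₃` of `V` and the dual basis `e₂∧e₃, e₃∧e₁, e₁∧e₂` of `Λ²V`:
on the first factor `g` acts naturally (on row vectors) and on the second
factor it acts by the matrix `det(g)·(g⁻¹)ᵀ` of `g ∧ g`. -/
def pairAct (g : GL (Fin 3) F) :
    ((Fin 3 → F) × (Fin 3 → F)) →ₗ[F] ((Fin 3 → F) × (Fin 3 → F)) :=
  LinearMap.prodMap
    (Matrix.vecMulLinear (g : Matrix (Fin 3) (Fin 3) F))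
    (Matrix.vecMulLinear
      ((g : Matrix (Fin 3) (Fin 3) F).det •
        ((↑(g⁻¹) : Matrix (Fin 3) (Fin 3) F)ᵀ)))

/-- `g` lies in the setwise stabilizer `GL(V)_U`. -/
def Stabilizes (g : GL (Fin 3) F) (U : Submodule F ((Fin 3 → F) × (Fin 3 → F))) :
    Prop :=
  Submodule.map (pairAct F g) U = U

/-- The subspace `W = ⟨e₁ − e₂∧e₃, e₂ − e₃∧e₁, e₃ − e₁∧e₂⟩`. -/
def Wsub : Submodule F ((Fin 3 → F) × (Fin 3 → F)) :=
  LinearMap.range (LinearMap.prod (LinearMap.id : (Fin 3 → F) →ₗ[F] (Fin 3 → F))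
    (-LinearMap.id))

variable {F}

/-- `pairAct` is a right action. -/
lemma pairAct_mul (g h : GL (Fin 3) F) :
    pairAct F (g * h) = pairAct F h ∘ₗ pairAct F g := by
  apply LinearMap.ext
  rintro ⟨v, w⟩
  refine Prod.ext ?_ ?_
  · simp [pairAct, Matrix.vecMul_vecMul]
  · simp only [pairAct, LinearMap.prodMap_apply, LinearMap.comp_apply, Matrix.vecMulLinear_apply,
      Matrix.vecMul_vecMul, _root_.mul_inv_rev, Units.val_mul, Matrix.transpose_mul, Matrix.det_mul,
      Matrix.smul_mul, Matrix.mul_smul, smul_smul, mul_comm h.1.det]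

lemma pairAct_one : pairAct F (1 : GL (Fin 3) F) = LinearMap.id := by
  apply LinearMap.ext
  rintro ⟨v, w⟩
  simp [pairAct]

lemma map_pairAct_mul (g h : GL (Fin 3) F)
    (U : Submodule F ((Fin 3 → F) × (Fin 3 → F))) :
    U.map (pairAct F (g * h)) = (U.map (pairAct F g)).map (pairAct F h) := by
  rw [pairAct_mul, Submodule.map_comp]

lemma map_pairAct_one (U : Submodule F ((Fin 3 → F) × (Fin 3 → F))) :
    U.map (pairAct F 1) = U := by
  rw [pairAct_one, Submodule.map_id]

/-- If `Ug = W` then the stabilizer of `U` is `g` times the stabilizer of `W` times `g⁻¹`. -/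
lemma setOf_stabilizes_eq_conj {g : GL (Fin 3) F}
    {U W : Submodule F ((Fin 3 → F) × (Fin 3 → F))} (hg : U.map (pairAct F g) = W) :
    {h : GL (Fin 3) F | Stabilizes F h U} =
      (fun k => g * k * g⁻¹) '' {h : GL (Fin 3) F | Stabilizes F h W} := by
  have hg' : W.map (pairAct F g⁻¹) = U := by
    rw [← hg, ← map_pairAct_mul, mul_inv_cancel, map_pairAct_one]
  ext h
  constructor
  · intro hh
    refine ⟨g⁻¹ * h * g, ?_, by group⟩
    simp only [Set.mem_ofPred_eq, Stabilizes] at hh ⊢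
    rw [map_pairAct_mul, map_pairAct_mul, hg', hh, hg]
  · rintro ⟨k, hk, rfl⟩
    simp only [Set.mem_ofPred_eq, Stabilizes] at hk ⊢
    rw [map_pairAct_mul, map_pairAct_mul, hg, hk, hg']

/-- The graph of right multiplication by `A`. -/
abbrev matGraph (A : Matrix (Fin 3) (Fin 3) F) :
    Submodule F ((Fin 3 → F) × (Fin 3 → F)) :=
  (Matrix.vecMulLinear A).graph

lemma matGraph_injective : Function.Injective (matGraph (F := F)) := by
  intro A B h
  apply Matrix.ext_of_single_vecMul
  intro i
  have : (Pi.single i 1, Pi.single i 1 ᵥ* A) ∈ matGraph B := by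
    rw [← h]
    simp [matGraph]
  simpa [matGraph] using this

lemma Wsub_eq_matGraph : Wsub F = matGraph (-1) := by
  ext ⟨v, w⟩
  simp only [Wsub, matGraph, LinearMap.mem_range, LinearMap.mem_graph_iff]
  constructor
  · rintro ⟨x, hx⟩
    simp at hx
    simp [← hx.1, ← hx.2]
  · intro h
    exact ⟨v, by simp at h; simp [h]⟩

lemma map_pairAct_matGraph_le {g : GL (Fin 3) F} {A B : Matrix (Fin 3) (Fin 3) F}
    (h : g.1.det • A = g.1 * B * g.1ᵀ) :
    (matGraph A).map (pairAct F g) ≤ matGraph B := by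
  rintro _ ⟨⟨v, w⟩, hv, rfl⟩
  simp only [matGraph, SetLike.mem_coe, LinearMap.mem_graph_iff, pairAct,
    LinearMap.prodMap_apply, Matrix.vecMulLinear_apply] at hv ⊢
  have hi : g.1ᵀ * (↑(g⁻¹) : Matrix (Fin 3) (Fin 3) F)ᵀ = 1 := by
    rw [← Matrix.transpose_mul, ← Units.val_mul, inv_mul_cancel, Units.val_one,
      Matrix.transpose_one]
  rw [hv, Matrix.vecMul_vecMul, Matrix.vecMul_vecMul]
  congr 1
  rw [Matrix.mul_smul, ← Matrix.smul_mul, h, mul_assoc, hi, mul_one]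

lemma map_pairAct_matGraph_eq_iff {g : GL (Fin 3) F} {A B : Matrix (Fin 3) (Fin 3) F} :
    (matGraph A).map (pairAct F g) = matGraph B ↔ g.1.det • A = g.1 * B * g.1ᵀ := by
  have key : ∀ {C : Matrix (Fin 3) (Fin 3) F}, g.1.det • A = g.1 * C * g.1ᵀ →
      (matGraph A).map (pairAct F g) = matGraph C := by
    intro C hC
    refine le_antisymm (map_pairAct_matGraph_le hC) ?_
    have hinv : (matGraph C).map (pairAct F g⁻¹) ≤ matGraph A := by
      apply map_pairAct_matGraph_le
      have h1 : (↑(g⁻¹) : Matrix (Fin 3) (Fin 3) F) * g.1 = 1 := by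
        rw [← Units.val_mul, inv_mul_cancel, Units.val_one]
      have h2 : g.1ᵀ * (↑(g⁻¹) : Matrix (Fin 3) (Fin 3) F)ᵀ = 1 := by
        rw [← Matrix.transpose_mul, h1, Matrix.transpose_one]
      have h3 : (↑(g⁻¹) : Matrix (Fin 3) (Fin 3) F).det * g.1.det = 1 := by
        rw [← Matrix.det_mul, h1, Matrix.det_one]
      change (↑(g⁻¹) : Matrix (Fin 3) (Fin 3) F).det • C =
        (↑(g⁻¹) : Matrix (Fin 3) (Fin 3) F) * A * (↑(g⁻¹) : Matrix (Fin 3) (Fin 3) F)ᵀ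
      calc _ = (↑(g⁻¹) : Matrix (Fin 3) (Fin 3) F).det •
            ((↑(g⁻¹) : Matrix (Fin 3) (Fin 3) F) * (g.1 * C * g.1ᵀ) *
              (↑(g⁻¹) : Matrix (Fin 3) (Fin 3) F)ᵀ) := by
            rw [mul_assoc g.1, ← mul_assoc _ g.1, h1, one_mul, mul_assoc, h2, mul_one]
        _ = _ := by
            rw [← hC, Matrix.mul_smul, Matrix.smul_mul, smul_smul, h3, one_smul]
    have := Submodule.map_mono (f := pairAct F g) hinv
    rwa [← map_pairAct_mul, inv_mul_cancel, map_pairAct_one] at this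
  refine ⟨fun h => ?_, key⟩
  have h1 : g.1 * (↑(g⁻¹) : Matrix (Fin 3) (Fin 3) F) = 1 := by
    rw [← Units.val_mul, mul_inv_cancel, Units.val_one]
  have h2 : (↑(g⁻¹) : Matrix (Fin 3) (Fin 3) F)ᵀ * g.1ᵀ = 1 := by
    rw [← Matrix.transpose_mul, h1, Matrix.transpose_one]
  have hC : g.1.det • A = g.1 * ((↑(g⁻¹) : Matrix (Fin 3) (Fin 3) F) * (g.1.det • A) *
      (↑(g⁻¹) : Matrix (Fin 3) (Fin 3) F)ᵀ) * g.1ᵀ := by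
    rw [mul_assoc, mul_assoc, mul_assoc, h2, mul_one, ← mul_assoc, h1, one_mul]
  rw [← matGraph_injective ((key hC).symm.trans h)]
  exact hC

lemma stabilizes_matGraph_iff {g : GL (Fin 3) F} {A : Matrix (Fin 3) (Fin 3) F}
    (hA : A.det ≠ 0) :
    Stabilizes F g (matGraph A) ↔ g.1 * A * g.1ᵀ = A ∧ g.1.det = 1 := by
  rw [Stabilizes, map_pairAct_matGraph_eq_iff]
  constructor
  · intro h
    have hg : g.1.det ≠ 0 := (g.1.isUnit_iff_isUnit_det.1 g.isUnit).ne_zero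
    have hd := congrArg Matrix.det h
    simp only [Matrix.det_smul, Matrix.det_mul, Matrix.det_transpose, Fintype.card_fin] at hd
    have h1 : g.1.det = 1 := by
      apply mul_left_cancel₀ (mul_ne_zero (mul_ne_zero hg hg) hA)
      linear_combination hd
    exact ⟨by rw [← h, h1, one_smul], h1⟩
  · rintro ⟨h, h1⟩
    rw [h, h1, one_smul]

/-- A three-dimensional subspace meeting both summands trivially is the graph of an invertible
matrix. -/
lemma exists_eq_matGraph {U : Submodule F ((Fin 3 → F) × (Fin 3 → F))}
    (hdim : Module.finrank F U = 3)
    (hUV : U ⊓ LinearMap.range (LinearMap.inl F (Fin 3 → F) (Fin 3 → F)) = ⊥)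
    (hUW : U ⊓ LinearMap.range (LinearMap.inr F (Fin 3 → F) (Fin 3 → F)) = ⊥) :
    ∃ A : Matrix (Fin 3) (Fin 3) F, A.det ≠ 0 ∧ U = matGraph A := by
  let p : U →ₗ[F] (Fin 3 → F) := LinearMap.fst F _ _ ∘ₗ U.subtype
  have hp : Function.Injective p := by
    rw [← LinearMap.ker_eq_bot, LinearMap.ker_eq_bot']
    rintro ⟨⟨v, w⟩, hu⟩ h
    have hv : v = 0 := h
    subst hv
    have : ((0, w) : (Fin 3 → F) × (Fin 3 → F)) ∈
        U ⊓ LinearMap.range (LinearMap.inr F (Fin 3 → F) (Fin 3 → F)) := ⟨hu, w, rfl⟩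
    rw [hUW] at this
    exact Subtype.ext this
  let e := LinearEquiv.ofInjectiveOfFinrankEq p hp (by simp [hdim])
  let f : (Fin 3 → F) →ₗ[F] (Fin 3 → F) :=
    LinearMap.snd F _ _ ∘ₗ U.subtype ∘ₗ e.symm.toLinearMap
  obtain ⟨A, hA⟩ : ∃ A : Matrix (Fin 3) (Fin 3) F, ∀ v, v ᵥ* A = f v := by
    refine ⟨(LinearMap.toMatrix' f)ᵀ, fun v => ?_⟩
    rw [Matrix.vecMul_transpose, LinearMap.toMatrix'_mulVec]
  have hmem : ∀ u : U, f (u : (Fin 3 → F) × (Fin 3 → F)).1 =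
      (u : (Fin 3 → F) × (Fin 3 → F)).2 := by
    intro u
    have : e.symm (u : (Fin 3 → F) × (Fin 3 → F)).1 = u := e.symm_apply_apply u
    simp [f, this]
  have hU : U = matGraph A := by
    ext ⟨v, w⟩
    simp only [matGraph, LinearMap.mem_graph_iff, Matrix.vecMulLinear_apply, hA]
    constructor
    · intro h
      exact (hmem ⟨_, h⟩).symm
    · rintro rfl
      have h1 : ((e.symm v : U) : (Fin 3 → F) × (Fin 3 → F)).1 = v := e.apply_symm_apply v
      have h2 : ((e.symm v : U) : (Fin 3 → F) × (Fin 3 → F)) = (v, f v) := Prod.ext h1 rfl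
      rw [← h2]
      exact (e.symm v).2
  refine ⟨A, fun h => ?_, hU⟩
  obtain ⟨v, hv, hvA⟩ := Matrix.exists_vecMul_eq_zero_iff.2 h
  have : ((v, 0) : (Fin 3 → F) × (Fin 3 → F)) ∈
      U ⊓ LinearMap.range (LinearMap.inl F (Fin 3 → F) (Fin 3 → F)) := by
    refine ⟨?_, v, rfl⟩
    rw [hU]
    simp [matGraph, hvA]
  rw [hUV] at this
  exact hv (congrArg Prod.fst ((Submodule.mem_bot F).1 this))

/-- Irreducibility of the group of isometries of determinant one forces `A` to be symmetric: the
radical of its skew-symmetric part is a nonzero invariant subspace. -/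
lemma transpose_eq_self_of_irreducible (hchar : ringChar F ≠ 2)
    {A : Matrix (Fin 3) (Fin 3) F}
    (hirr : ∀ S : Submodule F (Fin 3 → F),
      (∀ g : GL (Fin 3) F, g.1 * A * g.1ᵀ = A →
        Submodule.map (Matrix.vecMulLinear (g : Matrix (Fin 3) (Fin 3) F)) S = S) →
      S = ⊥ ∨ S = ⊤) : Aᵀ = A := by
  have h2 : (2 : F) ≠ 0 := Ring.two_ne_zero hchar
  set K := Aᵀ - A with hK
  have hdet : K.det = 0 := by
    have : K.det = -K.det := by
      conv_lhs => rw [← Matrix.det_transpose]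
      rw [show Kᵀ = -K by simp [hK], Matrix.det_neg]
      simp [pow_succ]
    have h : 2 * K.det = 0 := by linear_combination this
    exact (mul_eq_zero.1 h).resolve_left h2
  have hinv : ∀ g : GL (Fin 3) F, g.1 * A * g.1ᵀ = A →
      (LinearMap.ker (Matrix.vecMulLinear K)).map (Matrix.vecMulLinear g.1) =
        LinearMap.ker (Matrix.vecMulLinear K) := by
    intro g hg
    have hgK : g.1 * K * g.1ᵀ = K := by
      have := congrArg Matrix.transpose hg
      simp only [Matrix.transpose_mul, Matrix.transpose_transpose, ← mul_assoc] at this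
      rw [hK, mul_sub, sub_mul, hg, this]
    have hinj : Function.Injective (Matrix.vecMulLinear g.1) :=
      Matrix.vecMul_injective_of_isUnit g.isUnit
    have hinj' : Function.Injective (Matrix.vecMulLinear g.1ᵀ) :=
      Matrix.vecMul_injective_of_isUnit ((Matrix.isUnit_transpose _).2 g.isUnit)
    refine Submodule.eq_of_le_of_finrank_eq ?_ ((Submodule.equivMapOfInjective _ hinj _).symm.finrank_eq)
    rintro _ ⟨v, hv, rfl⟩
    apply hinj'
    have hv' : v ᵥ* K = 0 := hv
    simp only [Matrix.vecMulLinear_apply, Matrix.vecMul_vecMul, hgK, hv', map_zero]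
  rcases hirr (LinearMap.ker (Matrix.vecMulLinear K)) hinv with h | h
  · obtain ⟨v, hv, hvK⟩ := Matrix.exists_vecMul_eq_zero_iff.2 hdet
    have : v ∈ LinearMap.ker (Matrix.vecMulLinear K) := hvK
    rw [h] at this
    exact absurd this hv
  · rw [← sub_eq_zero, ← hK]
    apply Matrix.ext_of_single_vecMul
    intro i
    have : Pi.single i 1 ∈ LinearMap.ker (Matrix.vecMulLinear K) := h ▸ Submodule.mem_top
    simpa using this

/-- Over a finite field of odd characteristic, a nonzero binary diagonal form represents `1`. -/
lemma exists_mul_sq_add_mul_sq_eq_one [Finite F] (hchar : ringChar F ≠ 2) {a b : F}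
    (ha : a ≠ 0) (hb : b ≠ 0) : ∃ x y : F, a * x ^ 2 + b * y ^ 2 = 1 := by
  have := Fintype.ofFinite F
  obtain ⟨x, y, h⟩ := FiniteField.exists_root_sum_quadratic (R := F)
    (f := .C a * .X ^ 2) (g := .C b * .X ^ 2 - .C 1)
    (by simpa using Polynomial.degree_C_mul_X_pow 2 ha)
    (by rw [Polynomial.degree_sub_eq_left_of_degree_lt] <;>
      rw [Polynomial.degree_C_mul_X_pow 2 hb] <;> simp)
    (FiniteField.odd_card_of_char_ne_two hchar)
  refine ⟨x, y, ?_⟩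
  simp at h
  linear_combination h

/-- Over a finite field of odd characteristic, a diagonal ternary form whose discriminant is a
nonzero square is congruent to the standard one. -/
lemma exists_mul_diagonal_mul_transpose_eq_one [Finite F] (hchar : ringChar F ≠ 2) {d : Fin 3 → F}
    {s : F} (hs : s ≠ 0) (hd : d 0 * d 1 * d 2 = s ^ 2) :
    ∃ P : Matrix (Fin 3) (Fin 3) F, P * Matrix.diagonal d * Pᵀ = 1 := by
  have hne : d 0 * d 1 * d 2 ≠ 0 := hd ▸ pow_ne_zero 2 hs
  obtain ⟨h01, h2⟩ := mul_ne_zero_iff.1 hne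
  obtain ⟨h0, h1⟩ := mul_ne_zero_iff.1 h01
  obtain ⟨x, y, hxy⟩ := exists_mul_sq_add_mul_sq_eq_one hchar h0 h1
  obtain ⟨z, w, hzw⟩ := exists_mul_sq_add_mul_sq_eq_one hchar h01 h2
  have e1 : !![x, y, 0; -(d 1 * y), d 0 * x, 0; 0, 0, 1] * Matrix.diagonal d *
      !![x, y, 0; -(d 1 * y), d 0 * x, 0; 0, 0, 1]ᵀ =
      Matrix.diagonal ![1, d 0 * d 1, d 2] := by
    ext i j
    rw [Matrix.mul_apply, Fin.sum_univ_three]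
    simp only [Matrix.mul_diagonal]
    fin_cases i <;> fin_cases j <;> simp <;>
      first
        | ring1
        | linear_combination hxy
        | linear_combination d 0 * d 1 * hxy
  have e2 : !![1, 0, 0; 0, z, w; 0, -(d 2 * w) / s, d 0 * d 1 * z / s] *
      Matrix.diagonal ![1, d 0 * d 1, d 2] *
      !![1, 0, 0; 0, z, w; 0, -(d 2 * w) / s, d 0 * d 1 * z / s]ᵀ = 1 := by
    ext i j
    rw [Matrix.mul_apply, Fin.sum_univ_three]
    simp only [Matrix.mul_diagonal]
    fin_cases i <;> fin_cases j <;> simp <;>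
      first
        | ring1
        | linear_combination hzw
        | (field_simp
           linear_combination d 0 * d 1 * d 2 * hzw + hd)
  refine ⟨!![1, 0, 0; 0, z, w; 0, -(d 2 * w) / s, d 0 * d 1 * z / s] *
    !![x, y, 0; -(d 1 * y), d 0 * x, 0; 0, 0, 1], ?_⟩
  rw [← e2, ← e1, Matrix.transpose_mul]
  simp only [mul_assoc]

/-- A symmetric matrix in characteristic different from two is congruent to a diagonal one. -/
lemma exists_mul_mul_transpose_eq_diagonal (hchar : ringChar F ≠ 2)
    {n : ℕ} {B : Matrix (Fin n) (Fin n) F} (hB : Bᵀ = B) :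
    ∃ (P : Matrix (Fin n) (Fin n) F) (d : Fin n → F),
      IsUnit P ∧ P * B * Pᵀ = Matrix.diagonal d := by
  have := invertibleOfNonzero (Ring.two_ne_zero hchar)
  have hsymm := LinearMap.BilinForm.isSymm_iff.1 (Matrix.isSymm_toBilin'_iff_isSymm.2 hB)
  obtain ⟨v, hv⟩ := LinearMap.BilinForm.exists_orthogonal_basis hsymm
  let v' := v.reindex (finCongr (Module.finrank_fin_fun F))
  have hv' : ∀ i j, i ≠ j → v' i ⬝ᵥ B *ᵥ v' j = 0 := by
    intro i j hij
    rw [← Matrix.toBilin'_apply']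
    have := hv (i := (finCongr (Module.finrank_fin_fun F)).symm i)
      (j := (finCongr (Module.finrank_fin_fun F)).symm j) (by simpa using hij)
    simpa [v', Function.onFun] using this
  have hP : ∀ i j, (Matrix.of v' * B * (Matrix.of v')ᵀ) i j = v' i ⬝ᵥ B *ᵥ v' j := by
    intro i j
    rw [mul_assoc]
    rfl
  refine ⟨Matrix.of v', fun i => v' i ⬝ᵥ B *ᵥ v' i, ?_, ?_⟩
  · rw [← Matrix.linearIndependent_rows_iff_isUnit]
    exact v'.linearIndependent
  · ext i j
    rw [hP, Matrix.diagonal_apply]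
    split_ifs with h
    · rw [h]
    · exact hv' i j h

/-- Over a finite field of odd characteristic, a symmetric `3 × 3` matrix whose determinant is a
nonzero square is of the form `h hᵀ`. -/
lemma exists_eq_mul_transpose [Finite F] (hchar : ringChar F ≠ 2)
    {B : Matrix (Fin 3) (Fin 3) F} (hB : Bᵀ = B) {s : F} (hs : s ≠ 0) (hdet : B.det = s ^ 2) :
    ∃ h : GL (Fin 3) F, B = h.1 * h.1ᵀ := by
  obtain ⟨P, d, hP, hPB⟩ := exists_mul_mul_transpose_eq_diagonal hchar hB
  have hPdet : P.det ≠ 0 := (P.isUnit_iff_isUnit_det.1 hP).ne_zero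
  obtain ⟨Q, hQ⟩ := exists_mul_diagonal_mul_transpose_eq_one hchar (d := d)
    (mul_ne_zero hPdet hs) (by
      have := congrArg Matrix.det hPB
      simp only [Matrix.det_mul, Matrix.det_transpose, hdet, Matrix.det_diagonal,
        Fin.prod_univ_three] at this
      linear_combination -this)
  have hR : Q * P * (B * (Q * P)ᵀ) = 1 := by
    rw [← hQ, ← hPB, Matrix.transpose_mul]
    simp only [mul_assoc]
  have hR' : B * (Q * P)ᵀ * (Q * P) = 1 := mul_eq_one_comm.1 hR
  have hRt : (Q * P)ᵀ * (B * (Q * P)ᵀ)ᵀ = 1 := by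
    rw [← Matrix.transpose_mul, hR', Matrix.transpose_one]
  refine ⟨⟨B * (Q * P)ᵀ, Q * P, hR', hR⟩, ?_⟩
  change B = B * (Q * P)ᵀ * (B * (Q * P)ᵀ)ᵀ
  rw [mul_assoc, hRt, mul_one]

/-- Over a finite field of odd characteristic, every nondegenerate symmetric `3 × 3` matrix `B`
satisfies `det(g) B = g gᵀ` for some `g`. -/
lemma exists_det_smul_eq_mul_transpose [Finite F] (hchar : ringChar F ≠ 2)
    {B : Matrix (Fin 3) (Fin 3) F} (hB : Bᵀ = B) (hdet : B.det ≠ 0) :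
    ∃ g : GL (Fin 3) F, g.1.det • B = g.1 * g.1ᵀ := by
  obtain ⟨h, hh⟩ := exists_eq_mul_transpose hchar (B := B.det • B)
    (by rw [Matrix.transpose_smul, hB]) (pow_ne_zero 2 hdet)
    (by rw [Matrix.det_smul, Fintype.card_fin]; ring)
  have hdh : h.1.det ≠ 0 := (h.1.isUnit_iff_isUnit_det.1 h.isUnit).ne_zero
  have ht : B.det / h.1.det ≠ 0 := div_ne_zero hdet hdh
  refine ⟨Units.mk0 _ ht • h, ?_⟩
  change ((B.det / h.1.det) • h.1).det • B =
    ((B.det / h.1.det) • h.1) * ((B.det / h.1.det) • h.1)ᵀ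
  rw [Matrix.transpose_smul, Matrix.smul_mul, Matrix.mul_smul, ← hh, Matrix.det_smul,
    Fintype.card_fin, smul_smul, smul_smul]
  congr 1
  field_simp

variable (F)

theorem stmt6 [Finite F] (hchar : ringChar F ≠ 2)
    (U : Submodule F ((Fin 3 → F) × (Fin 3 → F)))
    (hdim : Module.finrank F U = 3)
    (hUV : U ⊓ LinearMap.range (LinearMap.inl F (Fin 3 → F) (Fin 3 → F)) = ⊥)
    (hUW : U ⊓ LinearMap.range (LinearMap.inr F (Fin 3 → F) (Fin 3 → F)) = ⊥)
    (hirr : ∀ S : Submodule F (Fin 3 → F),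
      (∀ g : GL (Fin 3) F, Stabilizes F g U →
        Submodule.map (Matrix.vecMulLinear (g : Matrix (Fin 3) (Fin 3) F)) S = S) →
      S = ⊥ ∨ S = ⊤) :
    ∃ g : GL (Fin 3) F,
      Submodule.map (pairAct F g) U = Wsub F ∧
      {h : GL (Fin 3) F | Stabilizes F h U} =
        (fun k => g * k * g⁻¹) '' {h : GL (Fin 3) F | Stabilizes F h (Wsub F)} ∧
      {h : GL (Fin 3) F | Stabilizes F h (Wsub F)} =
        {h : GL (Fin 3) F |
          (h : Matrix (Fin 3) (Fin 3) F) * (h : Matrix (Fin 3) (Fin 3) F)ᵀ = 1 ∧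
          (h : Matrix (Fin 3) (Fin 3) F).det = 1} := by
  obtain ⟨A, hA, rfl⟩ := exists_eq_matGraph hdim hUV hUW
  have hsymm : Aᵀ = A := transpose_eq_self_of_irreducible hchar fun S hS =>
    hirr S fun g hg => hS g ((stabilizes_matGraph_iff hA).1 hg).1
  obtain ⟨g, hg⟩ := exists_det_smul_eq_mul_transpose hchar (B := -A)
    (by rw [Matrix.transpose_neg, hsymm]) (by simpa [Matrix.det_neg] using hA)
  have hgW : (matGraph A).map (pairAct F g) = Wsub F := by
    rw [Wsub_eq_matGraph, map_pairAct_matGraph_eq_iff, mul_neg, mul_one, neg_mul, ← hg,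
      smul_neg, neg_neg]
  refine ⟨g, hgW, setOf_stabilizes_eq_conj hgW, ?_⟩
  ext h
  rw [Set.mem_ofPred_eq, Set.mem_ofPred_eq, Wsub_eq_matGraph,
    stabilizes_matGraph_iff (by simp [Matrix.det_neg]), mul_neg, mul_one, neg_mul, neg_inj]

end
end
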